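/- arXiv:1108.1555 — 2 statements merged into one kernel-verified Lean document; each statement's English description precedes it below -/
import Mathlib

section
/- Let n = 2 and d = (1,2). For all m_1, m_2, j ∈ ℕ, the dimension of the ℂ-vector space of polynomials f ∈ R of multidegree (m_1,m_2) with D1(f) = 0 and E(f) = j·f equals the coefficient of z_1^{m_1} z_2^{m_2} t^{j} in the formal power series (1 + z_1 z_2 t)·((1 − z_2 t²)(1 − z_2²)(1 − z_1 t)(1 − z_1² z_2))^{−1} ∈ ℤ[[z_1,z_2,t]]; i.e., the multivariate Poincaré series of the algebra of joint covariants of a binary linear form and a binary quadratic form equals (1 + z_1 z_2 t)/((1 − z_2 t²)(1 − z_2²)(1 − z_1 t)(1 − z_1² z_2)). -/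
open MvPolynomial

/-- Index type for the variables `v^{(k)}_j`, `1 ≤ k ≤ n`, `0 ≤ j ≤ d k`. -/
abbrev Idx (n : ℕ) (d : Fin n → ℕ) := Σ k : Fin n, Fin (d k + 1)

/-- The derivation `D1` with `D1 (v^{(k)}_j) = j • v^{(k)}_{j-1}`. -/
noncomputable def D1 (n : ℕ) (d : Fin n → ℕ) :
    Derivation ℂ (MvPolynomial (Idx n d) ℂ) (MvPolynomial (Idx n d) ℂ) :=
  mkDerivation ℂ (fun x =>
    if h : x.2.1 = 0 then 0
    else (x.2.1 : ℂ) • X ⟨x.1, ⟨x.2.1 - 1, by have := x.2.isLt; omega⟩⟩)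

/-- The derivation `D2` with `D2 (v^{(k)}_j) = (d k - j) • v^{(k)}_{j+1}`. -/
noncomputable def D2 (n : ℕ) (d : Fin n → ℕ) :
    Derivation ℂ (MvPolynomial (Idx n d) ℂ) (MvPolynomial (Idx n d) ℂ) :=
  mkDerivation ℂ (fun x =>
    if h : x.2.1 = d x.1 then 0
    else ((d x.1 - x.2.1 : ℕ) : ℂ) • X ⟨x.1, ⟨x.2.1 + 1, by have := x.2.isLt; omega⟩⟩)

/-- The derivation `E` with `E (v^{(k)}_j) = (d k - 2 j) • v^{(k)}_j`. -/
noncomputable def E (n : ℕ) (d : Fin n → ℕ) :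
    Derivation ℂ (MvPolynomial (Idx n d) ℂ) (MvPolynomial (Idx n d) ℂ) :=
  mkDerivation ℂ (fun x => ((d x.1 : ℂ) - 2 * (x.2.1 : ℂ)) • X x)

/-- The subspace of polynomials of multidegree `m`: every monomial has total degree
`m k` in the variables `v^{(k)}_0, …, v^{(k)}_{d k}`, for each `k`. -/
noncomputable def mdeg (n : ℕ) (d : Fin n → ℕ) (m : Fin n → ℕ) :
    Submodule ℂ (MvPolynomial (Idx n d) ℂ) where
  carrier := {f | ∀ α ∈ f.support, ∀ k : Fin n,
    (∑ j : Fin (d k + 1), α ⟨k, j⟩) = m k}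
  add_mem' := by
    intro f g hf hg α hα k
    rcases Finset.mem_union.mp (MvPolynomial.support_add hα) with h | h
    · exact hf α h k
    · exact hg α h k
  zero_mem' := by
    intro α hα k
    simp at hα
  smul_mem' := by
    intro c f hf α hα k
    exact hf α (MvPolynomial.support_smul hα) k

/-- `ω_d(m; i)`: the number of families of nonnegative integers
`(α^{(k)}_j)` with `∑_j α^{(k)}_j = m k` for each `k` and
`∑_{k,j} (d k - 2 j) ⬝ α^{(k)}_j = i`. -/
noncomputable def omegaCount (n : ℕ) (d : Fin n → ℕ) (m : Fin n → ℕ) (i : ℤ) : ℕ :=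
  Nat.card {α : Idx n d → ℕ //
    (∀ k : Fin n, (∑ j : Fin (d k + 1), α ⟨k, j⟩) = m k) ∧
    (∑ k : Fin n, ∑ j : Fin (d k + 1),
      ((d k : ℤ) - 2 * (j : ℕ)) * (α ⟨k, j⟩ : ℤ)) = i}

set_option linter.unusedSimpArgs false

abbrev PR := MvPolynomial (Idx 2 ![1, 2]) ℂ
noncomputable abbrev DD1 := D1 2 ![1, 2]
noncomputable abbrev DD2 := D2 2 ![1, 2]
noncomputable abbrev EE := E 2 ![1, 2]

/-- diagonal derivation -/
noncomputable def diagD (c : Idx 2 ![1, 2] → ℂ) : Derivation ℂ PR PR :=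
  mkDerivation ℂ (fun x => c x • X x)

lemma coeff_diagD (c : Idx 2 ![1, 2] → ℂ) (f : PR) (α : Idx 2 ![1, 2] →₀ ℕ) :
    coeff α (diagD c f) = (∑ x, c x * (α x : ℂ)) * coeff α f := by
  induction f using MvPolynomial.induction_on' with
  | add p q hp hq => simp [hp, hq, mul_add]
  | monomial u a =>
    have h : diagD c (monomial u a) = (∑ x, c x * (u x : ℂ)) • monomial u a := by
      rw [diagD, mkDerivation_monomial, Finsupp.sum_fintype _ _ (by simp), Finset.sum_smul,
        Finset.smul_sum]
      refine Finset.sum_congr rfl fun x _ => ?_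
      by_cases hx : u x = 0
      · simp [hx]
      · rw [smul_eq_mul, mul_smul_comm, X, monomial_mul, smul_monomial, smul_monomial,
          smul_monomial]
        have : u - Finsupp.single x 1 + Finsupp.single x 1 = u := by
          ext y
          by_cases hxy : x = y
          · subst hxy; simp; omega
          · simp [hxy]
        rw [this]
        simp only [smul_eq_mul]
        congr 1
        ring
    rw [h, coeff_smul, coeff_monomial]
    split_ifs with hu
    · subst hu; simp
    · simp

noncomputable def NN (k : Fin 2) : Derivation ℂ PR PR := diagD (fun x => if x.1 = k then 1 else 0)

lemma EE_eq : EE = diagD (fun x => ((![1, 2] : Fin 2 → ℕ) x.1 : ℂ) - 2 * (x.2.1 : ℂ)) := rfl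

abbrev a0 : Idx 2 ![1, 2] := ⟨0, (0 : Fin 2)⟩
abbrev a1 : Idx 2 ![1, 2] := ⟨0, (1 : Fin 2)⟩
abbrev b0 : Idx 2 ![1, 2] := ⟨1, (0 : Fin 3)⟩
abbrev b1 : Idx 2 ![1, 2] := ⟨1, (1 : Fin 3)⟩
abbrev b2 : Idx 2 ![1, 2] := ⟨1, (2 : Fin 3)⟩

lemma idx_cases {P : Idx 2 ![1, 2] → Prop} (h0 : P a0) (h1 : P a1) (h2 : P b0) (h3 : P b1)
    (h4 : P b2) (x : Idx 2 ![1, 2]) : P x := by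
  rcases x with ⟨k, j⟩
  fin_cases k <;> fin_cases j <;> assumption

lemma D1v_a0 : DD1 (X a0) = 0 := by
  rw [DD1, D1, mkDerivation_X]
  exact dif_pos rfl

lemma D1v_a1 : DD1 (X a1) = ((1 : ℕ) : ℂ) • X a0 := by
  rw [DD1, D1, mkDerivation_X]
  exact dif_neg (by decide)

lemma D1v_b0 : DD1 (X b0) = 0 := by
  rw [DD1, D1, mkDerivation_X]
  exact dif_pos rfl

lemma D1v_b1 : DD1 (X b1) = ((1 : ℕ) : ℂ) • X b0 := by
  rw [DD1, D1, mkDerivation_X]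
  exact dif_neg (by decide)

lemma D1v_b2 : DD1 (X b2) = ((2 : ℕ) : ℂ) • X b1 := by
  rw [DD1, D1, mkDerivation_X]
  exact dif_neg (by decide)

lemma D2v_a0 : DD2 (X a0) = ((1 - 0 : ℕ) : ℂ) • X a1 := by
  rw [DD2, D2, mkDerivation_X]
  exact dif_neg (by decide)

lemma D2v_a1 : DD2 (X a1) = 0 := by
  rw [DD2, D2, mkDerivation_X]
  exact dif_pos rfl

lemma D2v_b0 : DD2 (X b0) = ((2 - 0 : ℕ) : ℂ) • X b1 := by
  rw [DD2, D2, mkDerivation_X]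
  exact dif_neg (by decide)

lemma D2v_b1 : DD2 (X b1) = ((2 - 1 : ℕ) : ℂ) • X b2 := by
  rw [DD2, D2, mkDerivation_X]
  exact dif_neg (by decide)

lemma D2v_b2 : DD2 (X b2) = 0 := by
  rw [DD2, D2, mkDerivation_X]
  exact dif_pos rfl

lemma Ev_a0 : EE (X a0) = (((1 : ℕ) : ℂ) - 2 * ((0 : ℕ) : ℂ)) • X a0 := by
  rw [EE, E, mkDerivation_X]
  rfl

lemma N0v_a0 : NN 0 (X a0) = X a0 := by
  rw [NN, diagD, mkDerivation_X]
  simp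

lemma N1v_a0 : NN 1 (X a0) = 0 := by
  rw [NN, diagD, mkDerivation_X]
  simp

lemma Ev_a1 : EE (X a1) = (((1 : ℕ) : ℂ) - 2 * ((1 : ℕ) : ℂ)) • X a1 := by
  rw [EE, E, mkDerivation_X]
  rfl

lemma N0v_a1 : NN 0 (X a1) = X a1 := by
  rw [NN, diagD, mkDerivation_X]
  simp

lemma N1v_a1 : NN 1 (X a1) = 0 := by
  rw [NN, diagD, mkDerivation_X]
  simp

lemma Ev_b0 : EE (X b0) = (((2 : ℕ) : ℂ) - 2 * ((0 : ℕ) : ℂ)) • X b0 := by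
  rw [EE, E, mkDerivation_X]
  rfl

lemma N0v_b0 : NN 0 (X b0) = 0 := by
  rw [NN, diagD, mkDerivation_X]
  simp

lemma N1v_b0 : NN 1 (X b0) = X b0 := by
  rw [NN, diagD, mkDerivation_X]
  simp

lemma Ev_b1 : EE (X b1) = (((2 : ℕ) : ℂ) - 2 * ((1 : ℕ) : ℂ)) • X b1 := by
  rw [EE, E, mkDerivation_X]
  rfl

lemma N0v_b1 : NN 0 (X b1) = 0 := by
  rw [NN, diagD, mkDerivation_X]
  simp

lemma N1v_b1 : NN 1 (X b1) = X b1 := by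
  rw [NN, diagD, mkDerivation_X]
  simp

lemma Ev_b2 : EE (X b2) = (((2 : ℕ) : ℂ) - 2 * ((2 : ℕ) : ℂ)) • X b2 := by
  rw [EE, E, mkDerivation_X]
  rfl

lemma N0v_b2 : NN 0 (X b2) = 0 := by
  rw [NN, diagD, mkDerivation_X]
  simp

lemma N1v_b2 : NN 1 (X b2) = X b2 := by
  rw [NN, diagD, mkDerivation_X]
  simp

lemma comm_DD (f : PR) : DD1 (DD2 f) = DD2 (DD1 f) + EE f := by
  have : ⁅DD1, DD2⁆ = EE := by
    apply MvPolynomial.derivation_ext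
    intro x
    rw [Derivation.commutator_apply]
    induction x using idx_cases <;>
      simp only [D1v_a0, D1v_a1, D1v_b0, D1v_b1, D1v_b2, D2v_a0, D2v_a1, D2v_b0, D2v_b1, D2v_b2, Ev_a0, Ev_a1, Ev_b0, Ev_b1, Ev_b2, N0v_a0, N0v_a1, N0v_b0, N0v_b1, N0v_b2, N1v_a0, N1v_a1, N1v_b0, N1v_b1, N1v_b2, Derivation.map_smul, Derivation.smul_apply,
        map_zero] <;> push_cast <;> module
  rw [← this, Derivation.commutator_apply]; abel

lemma comm_E1 (f : PR) : EE (DD1 f) = DD1 (EE f) + (2 : ℂ) • DD1 f := by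
  have : ⁅EE, DD1⁆ = (2 : ℂ) • DD1 := by
    apply MvPolynomial.derivation_ext
    intro x
    rw [Derivation.commutator_apply]
    induction x using idx_cases <;>
      simp only [D1v_a0, D1v_a1, D1v_b0, D1v_b1, D1v_b2, D2v_a0, D2v_a1, D2v_b0, D2v_b1, D2v_b2, Ev_a0, Ev_a1, Ev_b0, Ev_b1, Ev_b2, N0v_a0, N0v_a1, N0v_b0, N0v_b1, N0v_b2, N1v_a0, N1v_a1, N1v_b0, N1v_b1, N1v_b2, Derivation.map_smul, Derivation.smul_apply,
        map_zero] <;> push_cast <;> module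
  have h := congrArg (fun D => D f) this
  simp only [Derivation.commutator_apply, Derivation.smul_apply] at h
  rw [← h]; abel

lemma comm_E2 (f : PR) : EE (DD2 f) = DD2 (EE f) + (-2 : ℂ) • DD2 f := by
  have : ⁅EE, DD2⁆ = (-2 : ℂ) • DD2 := by
    apply MvPolynomial.derivation_ext
    intro x
    rw [Derivation.commutator_apply]
    induction x using idx_cases <;>
      simp only [D1v_a0, D1v_a1, D1v_b0, D1v_b1, D1v_b2, D2v_a0, D2v_a1, D2v_b0, D2v_b1, D2v_b2, Ev_a0, Ev_a1, Ev_b0, Ev_b1, Ev_b2, N0v_a0, N0v_a1, N0v_b0, N0v_b1, N0v_b2, N1v_a0, N1v_a1, N1v_b0, N1v_b1, N1v_b2, Derivation.map_smul, Derivation.smul_apply,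
        map_zero] <;> push_cast <;> module
  have h := congrArg (fun D => D f) this
  simp only [Derivation.commutator_apply, Derivation.smul_apply] at h
  rw [← h]; abel

lemma comm_N1 (i : Fin 2) (f : PR) : NN i (DD1 f) = DD1 (NN i f) := by
  have : ⁅NN i, DD1⁆ = 0 := by
    apply MvPolynomial.derivation_ext
    intro x
    rw [Derivation.commutator_apply]
    fin_cases i <;> induction x using idx_cases <;>
      simp only [Fin.zero_eta, Fin.mk_one, D1v_a0, D1v_a1, D1v_b0, D1v_b1, D1v_b2, D2v_a0, D2v_a1, D2v_b0, D2v_b1, D2v_b2, Ev_a0, Ev_a1, Ev_b0, Ev_b1, Ev_b2, N0v_a0, N0v_a1, N0v_b0, N0v_b1, N0v_b2, N1v_a0, N1v_a1, N1v_b0, N1v_b1, N1v_b2, Derivation.map_smul, map_zero, smul_zero, sub_self,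
        Derivation.zero_apply]
  have h := congrArg (fun D => D f) this
  simp only [Derivation.commutator_apply, Derivation.zero_apply] at h
  exact sub_eq_zero.mp h

lemma comm_N2 (i : Fin 2) (f : PR) : NN i (DD2 f) = DD2 (NN i f) := by
  have : ⁅NN i, DD2⁆ = 0 := by
    apply MvPolynomial.derivation_ext
    intro x
    rw [Derivation.commutator_apply]
    fin_cases i <;> induction x using idx_cases <;>
      simp only [Fin.zero_eta, Fin.mk_one, D1v_a0, D1v_a1, D1v_b0, D1v_b1, D1v_b2, D2v_a0, D2v_a1, D2v_b0, D2v_b1, D2v_b2, Ev_a0, Ev_a1, Ev_b0, Ev_b1, Ev_b2, N0v_a0, N0v_a1, N0v_b0, N0v_b1, N0v_b2, N1v_a0, N1v_a1, N1v_b0, N1v_b1, N1v_b2, Derivation.map_smul, map_zero, smul_zero, sub_self,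
        Derivation.zero_apply]
  have h := congrArg (fun D => D f) this
  simp only [Derivation.commutator_apply, Derivation.zero_apply] at h
  exact sub_eq_zero.mp h

/-- exponent set -/
def SS (m₁ m₂ : ℕ) (w : ℤ) : Set (Idx 2 ![1, 2] →₀ ℕ) :=
  {α | α ⟨0, (0 : Fin 2)⟩ + α ⟨0, (1 : Fin 2)⟩ = m₁ ∧
    α ⟨1, (0 : Fin 3)⟩ + α ⟨1, (1 : Fin 3)⟩ + α ⟨1, (2 : Fin 3)⟩ = m₂ ∧
    (α ⟨0, (0 : Fin 2)⟩ : ℤ) - α ⟨0, (1 : Fin 2)⟩ + 2 * α ⟨1, (0 : Fin 3)⟩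
      - 2 * α ⟨1, (2 : Fin 3)⟩ = w}

noncomputable def VV (m₁ m₂ : ℕ) (w : ℤ) : Submodule ℂ PR :=
  mdeg 2 ![1, 2] ![m₁, m₂] ⊓ Module.End.eigenspace (EE.toLinearMap) (w : ℂ)

lemma sum_idx {M : Type*} [AddCommMonoid M] (g : Idx 2 ![1, 2] → M) :
    ∑ x, g x = (g ⟨0, (0 : Fin 2)⟩ + g ⟨0, (1 : Fin 2)⟩) +
      (g ⟨1, (0 : Fin 3)⟩ + g ⟨1, (1 : Fin 3)⟩ + g ⟨1, (2 : Fin 3)⟩) := by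
  rw [Fintype.sum_sigma, Fin.sum_univ_two]
  congr 1
  · exact Fin.sum_univ_two (fun j : Fin 2 => g ⟨0, j⟩)
  · exact Fin.sum_univ_three (fun j : Fin 3 => g ⟨1, j⟩)

lemma eig_diag (c : Idx 2 ![1, 2] → ℂ) (w : ℂ) (f : PR) :
    diagD c f = w • f ↔ ∀ α ∈ f.support, ∑ x, c x * (α x : ℂ) = w := by
  rw [MvPolynomial.ext_iff]
  refine forall_congr' fun α => ?_
  rw [coeff_diagD, coeff_smul, smul_eq_mul, mem_support_iff, mul_eq_mul_right_iff]
  tauto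

lemma mem_mdeg (m₁ m₂ : ℕ) (f : PR) : f ∈ mdeg 2 ![1, 2] ![m₁, m₂] ↔
    ∀ α ∈ f.support, α ⟨0, (0 : Fin 2)⟩ + α ⟨0, (1 : Fin 2)⟩ = m₁ ∧
    α ⟨1, (0 : Fin 3)⟩ + α ⟨1, (1 : Fin 3)⟩ + α ⟨1, (2 : Fin 3)⟩ = m₂ := by
  refine forall₂_congr fun α _ => ?_
  rw [Fin.forall_fin_two]
  have h1 := Fin.sum_univ_two (fun j : Fin 2 => α ⟨(0 : Fin 2), j⟩)
  have h2 := Fin.sum_univ_three (fun j : Fin 3 => α ⟨(1 : Fin 2), j⟩)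
  rw [← h1, ← h2]
  rfl

lemma mem_mdeg_iff (m₁ m₂ : ℕ) (f : PR) : f ∈ mdeg 2 ![1, 2] ![m₁, m₂] ↔
    NN 0 f = (m₁ : ℂ) • f ∧ NN 1 f = (m₂ : ℂ) • f := by
  rw [mem_mdeg, NN, NN, eig_diag, eig_diag, ← forall₂_and]
  refine forall₂_congr fun α _ => ?_
  rw [sum_idx, sum_idx]
  simp
  norm_cast

lemma mem_VV (m₁ m₂ : ℕ) (w : ℤ) (f : PR) : f ∈ VV m₁ m₂ w ↔
    NN 0 f = (m₁ : ℂ) • f ∧ NN 1 f = (m₂ : ℂ) • f ∧ EE f = (w : ℂ) • f := by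
  rw [VV, Submodule.mem_inf, mem_mdeg_iff, Module.End.mem_eigenspace_iff, and_assoc]
  rfl

lemma mem_VV' (m₁ m₂ : ℕ) (w : ℤ) (f : PR) : f ∈ VV m₁ m₂ w ↔
    ∀ α ∈ f.support, α ∈ SS m₁ m₂ w := by
  have : f ∈ VV m₁ m₂ w ↔ f ∈ mdeg 2 ![1, 2] ![m₁, m₂] ∧ EE f = (w : ℂ) • f := by
    rw [VV, Submodule.mem_inf, Module.End.mem_eigenspace_iff]; rfl
  rw [this, mem_mdeg, EE_eq, eig_diag, ← forall₂_and]
  refine forall₂_congr fun α _ => ?_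
  rw [sum_idx, SS, Set.mem_ofPred_eq, and_assoc]
  refine and_congr_right fun _ => and_congr_right fun _ => ?_
  rw [← Int.cast_inj (α := ℂ)]
  push_cast
  simp
  ring_nf

lemma VV_eq (m₁ m₂ : ℕ) (w : ℤ) : VV m₁ m₂ w = restrictSupport ℂ (SS m₁ m₂ w) := by
  ext f
  rw [mem_VV', mem_restrictSupport_iff]
  rfl

lemma D1_mem {m₁ m₂ : ℕ} {w : ℤ} {f : PR} (h : f ∈ VV m₁ m₂ w) : DD1 f ∈ VV m₁ m₂ (w + 2) := by
  rw [mem_VV] at h ⊢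
  obtain ⟨h0, h1, h2⟩ := h
  refine ⟨by rw [comm_N1, h0, Derivation.map_smul], by rw [comm_N1, h1, Derivation.map_smul], ?_⟩
  rw [comm_E1, h2, Derivation.map_smul, ← add_smul]; push_cast; rfl

lemma D2_mem {m₁ m₂ : ℕ} {w : ℤ} {f : PR} (h : f ∈ VV m₁ m₂ (w + 2)) : DD2 f ∈ VV m₁ m₂ w := by
  rw [mem_VV] at h ⊢
  obtain ⟨h0, h1, h2⟩ := h
  refine ⟨by rw [comm_N2, h0, Derivation.map_smul], by rw [comm_N2, h1, Derivation.map_smul], ?_⟩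
  rw [comm_E2, h2, Derivation.map_smul, ← add_smul]; push_cast; congr 1; ring

lemma D1_iter_mem {m₁ m₂ : ℕ} {w : ℤ} {f : PR} (h : f ∈ VV m₁ m₂ w) (k : ℕ) :
    (DD1)^[k] f ∈ VV m₁ m₂ (w + 2 * k) := by
  induction k with
  | zero => simpa using h
  | succ k ih =>
    rw [Function.iterate_succ_apply']
    have := D1_mem ih
    rwa [show w + 2 * ((k + 1 : ℕ) : ℤ) = w + 2 * k + 2 by push_cast; ring]

lemma VV_zero {m₁ m₂ : ℕ} {w : ℤ} {f : PR} (h : f ∈ VV m₁ m₂ w) (hw : m₁ + 2 * m₂ < w) :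
    f = 0 := by
  rw [mem_VV'] at h
  rw [← support_eq_empty, Finset.eq_empty_iff_forall_notMem]
  intro α hα
  obtain ⟨h0, h1, h2⟩ := h α hα
  omega

lemma D1_iter_D2 {m₁ m₂ : ℕ} {w : ℤ} {f : PR} (h : f ∈ VV m₁ m₂ w) (k : ℕ) :
    (DD1)^[k + 1] (DD2 f) = DD2 ((DD1)^[k + 1] f) +
      (((k + 1) * (w + k) : ℤ) : ℂ) • (DD1)^[k] f := by
  induction k with
  | zero =>
    rw [mem_VV] at h
    simp [comm_DD, h.2.2]
  | succ k ih =>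
    rw [Function.iterate_succ_apply', ih, map_add, comm_DD, ← Function.iterate_succ_apply' (⇑DD1),
      Derivation.map_smul, ← Function.iterate_succ_apply' (⇑DD1), 
      ((mem_VV _ _ _ _).1 (D1_iter_mem h (k + 1))).2.2, add_assoc, ← add_smul]
    congr 2
    push_cast
    ring

lemma iter_sub (k : ℕ) (f g : PR) : (DD1)^[k] (f - g) = (DD1)^[k] f - (DD1)^[k] g := by
  exact iterate_map_sub DD1 k f g
lemma iter_smul (k : ℕ) (c : ℂ) (f : PR) : (DD1)^[k] (c • f) = c • (DD1)^[k] f := by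
  induction k with
  | zero => rfl
  | succ k ih => rw [Function.iterate_succ_apply', ih, Derivation.map_smul, ← Function.iterate_succ_apply' (⇑DD1)]

lemma surj_aux {m₁ m₂ : ℕ} {w : ℤ} (hw : 0 < w + 2) (k : ℕ) : ∀ f ∈ VV m₁ m₂ (w + 2),
    (DD1)^[k] f = 0 → ∃ g ∈ VV m₁ m₂ w, DD1 g = f := by
  induction k with
  | zero => intro f _ h; exact ⟨0, zero_mem _, by simpa using Eq.symm h⟩
  | succ k ih =>
    intro f hf h
    set c : ℂ := (((k + 1) * ((w + 2) + k) : ℤ) : ℂ) with hc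
    have hc0 : c ≠ 0 := by
      rw [hc, Int.cast_ne_zero]
      have : (0:ℤ) < (k + 1) * ((w + 2) + k) := by positivity
      exact this.ne'
    have h1 := D1_iter_D2 hf k
    rw [h, map_zero, zero_add] at h1
    have h2 := D1_mem (D2_mem hf)
    obtain ⟨g, hg, hgf⟩ := ih (DD1 (DD2 f) - c • f) (sub_mem h2 (Submodule.smul_mem _ _ hf)) (by
      rw [iter_sub, iter_smul, ← Function.iterate_succ_apply, h1, sub_self])
    refine ⟨c⁻¹ • (DD2 f - g), Submodule.smul_mem _ _ (sub_mem (D2_mem hf) hg), ?_⟩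
    rw [Derivation.map_smul, map_sub, hgf, sub_sub_cancel, smul_smul, inv_mul_cancel₀ hc0, one_smul]

lemma surj {m₁ m₂ : ℕ} {w : ℤ} (hw : 0 < w + 2) (f : PR) (hf : f ∈ VV m₁ m₂ (w + 2)) :
    ∃ g ∈ VV m₁ m₂ w, DD1 g = f := by
  refine surj_aux hw (m₁ + 2 * m₂) f hf (VV_zero (D1_iter_mem hf _) ?_)
  push_cast; omega

/-- Weight multiplicity of the quadratic part. -/
def AA (m : ℕ) (w : ℤ) : ℤ :=
  if w % 2 = 0 ∧ |w| ≤ 2 * m then (m - |w| / 2) / 2 + 1 else 0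

def TT (m₁ m₂ : ℕ) (w : ℤ) : Finset (ℕ × ℕ) :=
  (Finset.range (m₁ + 1) ×ˢ Finset.range (m₂ + 1)).filter fun x =>
    (w - m₁ + 2 * x.1) % 2 = 0 ∧ 0 ≤ x.2 + (w - m₁ + 2 * x.1) / 2 ∧
      2 * x.2 + (w - m₁ + 2 * x.1) / 2 ≤ m₂

lemma card_TT (m₁ m₂ : ℕ) (w : ℤ) : ((TT m₁ m₂ w).card : ℤ) =
    ∑ p ∈ Finset.range (m₁ + 1), AA m₂ (w - m₁ + 2 * p) := by
  rw [TT, Finset.card_filter, Finset.sum_product]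
  push_cast
  refine Finset.sum_congr rfl fun p _ => ?_
  generalize w - m₁ + 2 * (p : ℤ) = v
  have : (∑ x ∈ Finset.range (m₂ + 1), if v % 2 = 0 ∧ 0 ≤ (x : ℤ) + v / 2 ∧ 2 * (x : ℤ) + v / 2 ≤ m₂
      then (1:ℤ) else 0) = ((Finset.range (m₂ + 1)).filter fun x : ℕ => v % 2 = 0 ∧
        0 ≤ (x : ℤ) + v / 2 ∧ 2 * (x : ℤ) + v / 2 ≤ m₂).card := by
    rw [Finset.card_filter]; push_cast; rfl
  rw [this, AA]
  split_ifs with h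
  · have : ((Finset.range (m₂ + 1)).filter fun x : ℕ => v % 2 = 0 ∧
        0 ≤ (x : ℤ) + v / 2 ∧ 2 * (x : ℤ) + v / 2 ≤ m₂) =
        Finset.Ico (max 0 (-(v/2))).toNat (((m₂ - v / 2) / 2) + 1).toNat := by
      ext x
      simp only [Finset.mem_filter, Finset.mem_range, Finset.mem_Ico]
      rcases abs_cases v with ⟨h1, h2⟩ | ⟨h1, h2⟩ <;> rw [h1] at h <;> omega
    rw [this, Nat.card_Ico]
    rcases abs_cases v with ⟨h1, h2⟩ | ⟨h1, h2⟩ <;> rw [h1] at h ⊢ <;> omega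
  · rw [Nat.cast_eq_zero, Finset.card_eq_zero, Finset.filter_eq_empty_iff]
    intro x hx
    rw [Finset.mem_range] at hx
    rcases abs_cases v with ⟨h1, h2⟩ | ⟨h1, h2⟩ <;> rw [h1] at h <;> omega

lemma equiv_SS (m₁ m₂ : ℕ) (w : ℤ) :
    Nonempty (SS m₁ m₂ w ≃ (TT m₁ m₂ w : Set (ℕ × ℕ))) := by
  refine Nonempty.intro (Equiv.ofBijective
    (fun α => ⟨(α.1 ⟨0, (1 : Fin 2)⟩, α.1 ⟨1, (2 : Fin 3)⟩), ?_⟩) ⟨?_, ?_⟩)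
  · obtain ⟨α, h0, h1, h2⟩ := α
    simp only [TT, Finset.coe_filter, Finset.mem_product, Finset.mem_range, Set.mem_ofPred_eq]
    omega
  · rintro ⟨α, h0, h1, h2⟩ ⟨β, g0, g1, g2⟩ h
    simp only [Subtype.mk.injEq, Prod.mk.injEq] at h ⊢
    ext ⟨k, i⟩
    fin_cases k <;> fin_cases i
    all_goals simp only [Fin.zero_eta, Fin.mk_one, Fin.reduceFinMk]
    · change α ⟨0, (0 : Fin 2)⟩ = β ⟨0, (0 : Fin 2)⟩; omega
    · exact h.1
    · change α ⟨1, (0 : Fin 3)⟩ = β ⟨1, (0 : Fin 3)⟩; omega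
    · change α ⟨1, (1 : Fin 3)⟩ = β ⟨1, (1 : Fin 3)⟩; omega
    · exact h.2
  · rintro ⟨⟨p, q⟩, h⟩
    simp only [TT, Finset.coe_filter, Finset.mem_product, Finset.mem_range, Set.mem_ofPred_eq] at h
    set b : ℕ := ((q : ℤ) + (w - m₁ + 2 * p) / 2).toNat with hb
    refine ⟨⟨Finsupp.equivFunOnFinite.symm (fun x : Idx 2 ![1, 2] =>
      if x.1 = 0 then (if x.2.1 = 0 then m₁ - p else p)
      else (if x.2.1 = 0 then b else if x.2.1 = 1 then m₂ - b - q else q)), ?_⟩, ?_⟩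
    · refine ⟨?_, ?_, ?_⟩
      · change m₁ - p + p = m₁
        omega
      · change b + (m₂ - b - q) + q = m₂
        omega
      · change ((m₁ - p : ℕ) : ℤ) - (p : ℤ) + 2 * (b : ℤ) - 2 * (q : ℤ) = w
        omega
    · rfl

lemma card_SS (m₁ m₂ : ℕ) (w : ℤ) : Nat.card (SS m₁ m₂ w) = (TT m₁ m₂ w).card := by
  have hT : Nat.card (TT m₁ m₂ w : Set (ℕ × ℕ)) = (TT m₁ m₂ w).card := by simp
  rw [← hT]
  exact Nat.card_congr (equiv_SS m₁ m₂ w).some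

lemma finite_SS (m₁ m₂ : ℕ) (w : ℤ) : Finite (SS m₁ m₂ w) :=
  Finite.of_equiv _ (equiv_SS m₁ m₂ w).some.symm

lemma finrank_VV (m₁ m₂ : ℕ) (w : ℤ) : (Module.finrank ℂ (VV m₁ m₂ w) : ℤ) =
    ∑ p ∈ Finset.range (m₁ + 1), AA m₂ (w - m₁ + 2 * p) := by
  rw [VV_eq, Module.finrank_eq_nat_card_basis (basisRestrictSupport ℂ (SS m₁ m₂ w)), card_SS,
    card_TT]

instance (m₁ m₂ : ℕ) (w : ℤ) : Module.Finite ℂ (VV m₁ m₂ w) := by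
  have : Finite (SS m₁ m₂ w) := finite_SS m₁ m₂ w
  rw [VV_eq]
  exact Module.Finite.of_basis (basisRestrictSupport ℂ (SS m₁ m₂ w))

lemma finrank_main (m₁ m₂ j : ℕ) : (Module.finrank ℂ ↥(mdeg 2 ![1, 2] ![m₁, m₂] ⊓
        LinearMap.ker (D1 2 ![1, 2]).toLinearMap ⊓
        Module.End.eigenspace ((E 2 ![1, 2]).toLinearMap) (j : ℂ)) : ℤ) =
      AA m₂ (j - m₁) - AA m₂ (j + m₁ + 2) := by
  let φ : VV m₁ m₂ j →ₗ[ℂ] PR := DD1.toLinearMap.domRestrict (VV m₁ m₂ j)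
  have hr : LinearMap.range φ = VV m₁ m₂ (j + 2) := by
    ext f
    constructor
    · rintro ⟨g, rfl⟩
      exact D1_mem g.2
    · intro hf
      obtain ⟨g, hg, hgf⟩ := surj (by omega) f hf
      exact ⟨⟨g, hg⟩, hgf⟩
  have hk : (LinearMap.ker φ).map (VV m₁ m₂ j).subtype = mdeg 2 ![1, 2] ![m₁, m₂] ⊓
        LinearMap.ker (D1 2 ![1, 2]).toLinearMap ⊓
        Module.End.eigenspace ((E 2 ![1, 2]).toLinearMap) (j : ℂ) := by
    have : VV m₁ m₂ j = mdeg 2 ![1, 2] ![m₁, m₂] ⊓ 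
        Module.End.eigenspace ((E 2 ![1, 2]).toLinearMap) (j : ℂ) := by
      rw [VV]; simp
    rw [inf_right_comm, ← this]
    ext f
    simp only [Submodule.mem_map, Submodule.mem_inf]
    constructor
    · rintro ⟨g, hg, rfl⟩
      exact ⟨g.2, hg⟩
    · rintro ⟨h1, h2⟩
      exact ⟨⟨f, h1⟩, h2, rfl⟩
  rw [← hk, Submodule.finrank_map_subtype_eq]
  have h := LinearMap.finrank_range_add_finrank_ker φ
  rw [hr] at h
  have h1 := finrank_VV m₁ m₂ j
  have h2 := finrank_VV m₁ m₂ (j + 2)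
  rw [Finset.sum_range_succ'] at h1
  rw [Finset.sum_range_succ] at h2
  have e : ∑ k ∈ Finset.range m₁, AA m₂ ((j:ℤ) - m₁ + 2 * ((k + 1 : ℕ) : ℤ)) =
     ∑ k ∈ Finset.range m₁, AA m₂ ((j:ℤ) + 2 - m₁ + 2 * (k : ℤ)) := by
    refine Finset.sum_congr rfl fun k _ => ?_
    congr 1; push_cast; ring
  have e1 : (j:ℤ) + 2 - m₁ + 2 * (m₁ : ℤ) = j + m₁ + 2 := by ring
  rw [e] at h1
  rw [e1] at h2
  simp only [Nat.cast_zero, mul_zero, add_zero] at h1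
  zify at h
  linarith

noncomputable def mk3 (g : ℕ → ℕ → ℕ → ℤ) : MvPowerSeries (Fin 2 ⊕ Unit) ℤ :=
  fun n => g (n (Sum.inl 0)) (n (Sum.inl 1)) (n (Sum.inr ()))

lemma coeff_mk3 (g : ℕ → ℕ → ℕ → ℤ) (n : Fin 2 ⊕ Unit →₀ ℕ) :
    MvPowerSeries.coeff n (mk3 g) = g (n (Sum.inl 0)) (n (Sum.inl 1)) (n (Sum.inr ())) := rfl

noncomputable def ex3 (a b c : ℕ) : Fin 2 ⊕ Unit →₀ ℕ :=
  Finsupp.single (Sum.inl 0) a + Finsupp.single (Sum.inl 1) b + Finsupp.single (Sum.inr ()) c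

lemma ex3_0 (a b c : ℕ) : ex3 a b c (Sum.inl 0) = a := by simp [ex3]
lemma ex3_1 (a b c : ℕ) : ex3 a b c (Sum.inl 1) = b := by simp [ex3]
lemma ex3_2 (a b c : ℕ) : ex3 a b c (Sum.inr ()) = c := by simp [ex3]

lemma ex3_le (a b c : ℕ) (n : Fin 2 ⊕ Unit →₀ ℕ) : ex3 a b c ≤ n ↔
    a ≤ n (Sum.inl 0) ∧ b ≤ n (Sum.inl 1) ∧ c ≤ n (Sum.inr ()) := by
  rw [Finsupp.le_def]
  constructor
  · intro h
    have h0 := h (Sum.inl 0)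
    have h1 := h (Sum.inl 1)
    have h2 := h (Sum.inr ())
    rw [ex3_0] at h0
    rw [ex3_1] at h1
    rw [ex3_2] at h2
    exact ⟨h0, h1, h2⟩
  · rintro ⟨h0, h1, h2⟩ (i | i)
    · fin_cases i
      · exact (ex3_0 a b c).trans_le h0
      · exact (ex3_1 a b c).trans_le h1
    · exact (ex3_2 a b c).trans_le h2

lemma mon3 (a b c : ℕ) : (MvPowerSeries.monomial (ex3 a b c) (1 : ℤ)) =
    MvPowerSeries.X (Sum.inl 0 : Fin 2 ⊕ Unit) ^ a * MvPowerSeries.X (Sum.inl 1) ^ b *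
      MvPowerSeries.X (Sum.inr ()) ^ c := by
  rw [MvPowerSeries.X_pow_eq, MvPowerSeries.X_pow_eq, MvPowerSeries.X_pow_eq,
    MvPowerSeries.monomial_mul_monomial, MvPowerSeries.monomial_mul_monomial, ex3]
  simp

lemma mk3_mul (g g' : ℕ → ℕ → ℕ → ℤ) (a b c : ℕ)
    (h : ∀ x y z, g' x y z = g x y z -
      if a ≤ x ∧ b ≤ y ∧ c ≤ z then g (x - a) (y - b) (z - c) else 0) :
    mk3 g * (1 - MvPowerSeries.X (Sum.inl 0 : Fin 2 ⊕ Unit) ^ a * MvPowerSeries.X (Sum.inl 1) ^ b *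
      MvPowerSeries.X (Sum.inr ()) ^ c) = mk3 g' := by
  ext n
  rw [← mon3, mul_sub, mul_one, map_sub, MvPowerSeries.coeff_mul_monomial, mul_one,
    coeff_mk3, coeff_mk3, coeff_mk3, h]
  congr 1
  simp only [ex3_le, coeff_mk3, Finsupp.tsub_apply, ex3_0, ex3_1, ex3_2]

lemma AA_neg (m : ℕ) (w : ℤ) : AA m (-w) = AA m w := by
  simp only [AA, abs_neg]
  congr 2
  simp only [eq_iff_iff]
  omega

lemma AA_diff (m : ℕ) (w : ℤ) (hw : 0 ≤ w) : AA m w - AA m (w + 2) =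
    if w ≤ 2 * m ∧ (2 * m - w) % 4 = 0 then 1 else 0 := by
  simp only [AA, abs_of_nonneg hw, abs_of_nonneg (show 0 ≤ w + 2 by omega)]
  split_ifs <;> omega

lemma series_eq :
    mk3 (fun x y z => AA y (z - x) - AA y (z + x + 2)) *
      ((1 - MvPowerSeries.X (Sum.inl 1 : Fin 2 ⊕ Unit) *
              MvPowerSeries.X (Sum.inr ()) ^ 2) *
           (1 - MvPowerSeries.X (Sum.inl 1 : Fin 2 ⊕ Unit) ^ 2) *
           (1 - MvPowerSeries.X (Sum.inl 0 : Fin 2 ⊕ Unit) *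
              MvPowerSeries.X (Sum.inr ())) *
           (1 - MvPowerSeries.X (Sum.inl 0 : Fin 2 ⊕ Unit) ^ 2 *
              MvPowerSeries.X (Sum.inl 1))) =
    1 + MvPowerSeries.X (Sum.inl 0 : Fin 2 ⊕ Unit) *
            MvPowerSeries.X (Sum.inl 1) * MvPowerSeries.X (Sum.inr ()) := by
  have h1 := mk3_mul (fun x y z => AA y (z - x) - AA y (z + x + 2))
    (fun x y z => if ((z : ℤ) + x) ≤ 2 * y ∧ (2 * y - ((z : ℤ) + x)) % 4 = 0 then 1 else 0) 1 0 1 (by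
      intro x y z
      rw [← AA_diff y (z + x) (by omega)]
      split_ifs with h
      · have e1 : ((z - 1 : ℕ) : ℤ) - ((x - 1 : ℕ) : ℤ) = z - x := by omega
        have e2 : ((z - 1 : ℕ) : ℤ) + ((x - 1 : ℕ) : ℤ) + 2 = z + x := by omega
        rw [e1, e2, Nat.sub_zero]
        ring
      · have : x = 0 ∨ z = 0 := by omega
        rcases this with rfl | rfl
        · simp
        · simp [AA_neg])
  have h2 := mk3_mul
    (fun x y z => if ((z : ℤ) + x) ≤ 2 * y ∧ (2 * y - ((z : ℤ) + x)) % 4 = 0 then 1 else 0)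
    (fun x y z => if z + x = 2 * y then 1 else 0) 0 2 0 (by
      intro x y z
      split_ifs <;> omega)
  have h3 := mk3_mul
    (fun x y z => if z + x = 2 * y then 1 else 0)
    (fun x y z => if z + x = 2 * y ∧ z ≤ 1 then 1 else 0) 0 1 2 (by
      intro x y z
      split_ifs <;> omega)
  have h4 := mk3_mul
    (fun x y z => if z + x = 2 * y ∧ z ≤ 1 then 1 else 0)
    (fun x y z => if (x = 0 ∧ y = 0 ∧ z = 0) ∨ (x = 1 ∧ y = 1 ∧ z = 1) then 1 else 0) 2 1 0 (by
      intro x y z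
      split_ifs <;> omega)
  have h5 : mk3 (fun x y z => if (x = 0 ∧ y = 0 ∧ z = 0) ∨ (x = 1 ∧ y = 1 ∧ z = 1) then 1 else 0) =
      1 + MvPowerSeries.X (Sum.inl 0 : Fin 2 ⊕ Unit) *
            MvPowerSeries.X (Sum.inl 1) * MvPowerSeries.X (Sum.inr ()) := by
    have := mon3 1 1 1
    simp only [pow_one] at this
    rw [← this]
    have h0 : (1 : MvPowerSeries (Fin 2 ⊕ Unit) ℤ) = MvPowerSeries.monomial (ex3 0 0 0) 1 := by
      rw [mon3]; simp
    rw [h0]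
    have key : ∀ (a b c : ℕ) (n : Fin 2 ⊕ Unit →₀ ℕ), n = ex3 a b c ↔
        n (Sum.inl 0) = a ∧ n (Sum.inl 1) = b ∧ n (Sum.inr ()) = c := by
      intro a b c n
      constructor
      · rintro rfl; exact ⟨ex3_0 .., ex3_1 .., ex3_2 ..⟩
      · rintro ⟨h0, h1, h2⟩
        ext (i | i)
        · fin_cases i
          · exact h0.trans (ex3_0 ..).symm
          · exact h1.trans (ex3_1 ..).symm
        · exact h2.trans (ex3_2 ..).symm
    ext n
    rw [map_add, MvPowerSeries.coeff_monomial, MvPowerSeries.coeff_monomial, coeff_mk3]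
    simp only [key]
    split_ifs <;> omega
  rw [← h5, ← h4, ← h3, ← h2, ← h1]
  ring

theorem poincare_series_covariants_d12 (m₁ m₂ j : ℕ) :
    (Module.finrank ℂ ↥(mdeg 2 ![1, 2] ![m₁, m₂] ⊓
        LinearMap.ker (D1 2 ![1, 2]).toLinearMap ⊓
        Module.End.eigenspace ((E 2 ![1, 2]).toLinearMap) (j : ℂ)) : ℤ) =
      MvPowerSeries.coeff (R := ℤ)
        (Finsupp.equivFunOnFinite.symm (Sum.elim ![m₁, m₂] fun _ => j))
        ((1 + MvPowerSeries.X (Sum.inl 0 : Fin 2 ⊕ Unit) *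
            MvPowerSeries.X (Sum.inl 1) * MvPowerSeries.X (Sum.inr ())) *
         MvPowerSeries.invOfUnit
          ((1 - MvPowerSeries.X (Sum.inl 1 : Fin 2 ⊕ Unit) *
              MvPowerSeries.X (Sum.inr ()) ^ 2) *
           (1 - MvPowerSeries.X (Sum.inl 1 : Fin 2 ⊕ Unit) ^ 2) *
           (1 - MvPowerSeries.X (Sum.inl 0 : Fin 2 ⊕ Unit) *
              MvPowerSeries.X (Sum.inr ())) *
           (1 - MvPowerSeries.X (Sum.inl 0 : Fin 2 ⊕ Unit) ^ 2 *
              MvPowerSeries.X (Sum.inl 1))) 1) := by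
  rw [finrank_main, ← series_eq, mul_assoc, MvPowerSeries.mul_invOfUnit _ _ (by simp), mul_one,
    coeff_mk3]
  simp
end

section
/- Let n = 2 and d = (1,3). For all m_1, m_2 ∈ ℕ, the dimension of the ℂ-vector space of joint invariants of multidegree (m_1,m_2), i.e., polynomials f ∈ R of multidegree (m_1,m_2) with D1(f) = 0 and D2(f) = 0, equals the coefficient of z_1^{m_1} z_2^{m_2} in the formal power series (1 + z_1² z_2² − z_1 z_2)·((1 − z_2⁴)(1 − z_1³ z_2)(1 − z_1 z_2))^{−1} ∈ ℤ[[z_1,z_2]]; i.e., the multivariate Poincaré series of the algebra of joint invariants of a binary linear form and a binary cubic form equals (1 + z_1² z_2² − z_1 z_2)/((1 − z_2⁴)(1 − z_1³ z_2)(1 − z_1 z_2)). -/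
open MvPolynomial

section SlTwo

variable {n : ℕ} {d : Fin n → ℕ}

/-- Diagonal derivation. -/
noncomputable def Dg (u : Idx n d → ℂ) :
    Derivation ℂ (MvPolynomial (Idx n d) ℂ) (MvPolynomial (Idx n d) ℂ) :=
  mkDerivation ℂ (fun x => u x • X x)

lemma Dg_monomial (u : Idx n d → ℂ) (α : Idx n d →₀ ℕ) (c : ℂ) :
    Dg u (monomial α c) = (∑ x, u x * α x) • monomial α c := by
  rw [Dg, mkDerivation_monomial, Finsupp.sum_fintype _ _ (by simp), Finset.sum_smul]
  rw [Finset.smul_sum]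
  refine Finset.sum_congr rfl fun x _ => ?_
  by_cases hx : α x = 0
  · simp [hx]
  · have : α - Finsupp.single x 1 + Finsupp.single x 1 = α :=
      tsub_add_cancel_of_le (by simpa using Nat.one_le_iff_ne_zero.mpr hx)
    rw [smul_eq_mul, mul_smul_comm, X, monomial_mul, this, smul_monomial, smul_monomial,
      smul_monomial]
    congr 1
    simp only [smul_eq_mul]; ring

lemma coeff_Dg (u : Idx n d → ℂ) (α : Idx n d →₀ ℕ) (f : MvPolynomial (Idx n d) ℂ) :
    coeff α (Dg u f) = (∑ x, u x * α x) * coeff α f := by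
  classical
  induction f using MvPolynomial.induction_on' with
  | monomial β c =>
    rw [Dg_monomial, coeff_smul, coeff_monomial, smul_eq_mul]
    split_ifs with h
    · rw [h]
    · simp
  | add p q hp hq => rw [map_add, coeff_add, coeff_add, hp, hq, mul_add]

lemma der_sum {ι : Type} (s : Finset ι)
    (D : ι → Derivation ℂ (MvPolynomial (Idx n d) ℂ) (MvPolynomial (Idx n d) ℂ))
    (f : MvPolynomial (Idx n d) ℂ) : (∑ i ∈ s, D i) f = ∑ i ∈ s, D i f := by
  classical
  induction s using Finset.induction_on with
  | empty => simp
  | insert i s hi ih =>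
    rw [Finset.sum_insert hi, Finset.sum_insert hi, Derivation.add_apply, ih]

lemma D1_eq : D1 n d = ∑ k : Fin n, ∑ j : Fin (d k),
    ((j : ℂ) + 1) • (X ⟨k, j.castSucc⟩ : MvPolynomial (Idx n d) ℂ) • pderiv (⟨k, j.succ⟩ : Idx n d) := by
  classical
  apply derivation_ext
  rintro ⟨k, i⟩
  rw [D1, mkDerivation_X]
  simp only [der_sum, Derivation.smul_apply, pderiv_X]
  rw [Finset.sum_eq_single k]
  · refine Fin.cases ?_ (fun i => ?_) i
    · rw [dif_pos (by rfl)]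
      symm
      apply Finset.sum_eq_zero
      intro j _
      rw [Pi.single_eq_of_ne]
      · simp
      · intro h
        have := eq_of_heq (Sigma.mk.inj h).2
        exact absurd this (Fin.succ_ne_zero j).symm
    · rw [dif_neg (by simp), Finset.sum_eq_single i]
      · simp; rfl
      · intro j _ hj
        rw [Pi.single_eq_of_ne]
        · simp
        · intro h
          have := eq_of_heq (Sigma.mk.inj h).2
          exact hj (Fin.succ_injective _ this).symm
      · simp
  · intro l _ hl
    apply Finset.sum_eq_zero
    intro j _
    rw [Pi.single_eq_of_ne]
    · simp
    · intro h
      exact hl (Sigma.mk.inj h).1.symm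
  · simp

lemma D2_eq : D2 n d = ∑ k : Fin n, ∑ j : Fin (d k),
    ((d k : ℂ) - j) • (X ⟨k, j.succ⟩ : MvPolynomial (Idx n d) ℂ) • pderiv (⟨k, j.castSucc⟩ : Idx n d) := by
  classical
  apply derivation_ext
  rintro ⟨k, i⟩
  rw [D2, mkDerivation_X]
  simp only [der_sum, Derivation.smul_apply, pderiv_X]
  rw [Finset.sum_eq_single k]
  · refine Fin.lastCases ?_ (fun i => ?_) i
    · rw [dif_pos (by rfl)]
      symm
      apply Finset.sum_eq_zero
      intro j _
      rw [Pi.single_eq_of_ne]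
      · simp
      · intro h
        have := eq_of_heq (Sigma.mk.inj h).2
        exact absurd this (Fin.castSucc_lt_last j).ne'
    · rw [dif_neg (by simpa using i.isLt.ne), Finset.sum_eq_single i]
      · simp [Nat.cast_sub i.isLt.le]; rfl
      · intro j _ hj
        rw [Pi.single_eq_of_ne]
        · simp
        · intro h
          have := eq_of_heq (Sigma.mk.inj h).2
          exact hj (Fin.castSucc_injective _ this).symm
      · simp
  · intro l _ hl
    apply Finset.sum_eq_zero
    intro j _
    rw [Pi.single_eq_of_ne]
    · simp
    · intro h
      exact hl (Sigma.mk.inj h).1.symm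
  · simp

lemma D1_X_zero (k : Fin n) : D1 n d (X ⟨k, 0⟩) = 0 := by
  rw [D1, mkDerivation_X, dif_pos (by rfl)]

lemma D1_X_succ (k : Fin n) (j : Fin (d k)) :
    D1 n d (X ⟨k, j.succ⟩) = ((j : ℂ) + 1) • X ⟨k, j.castSucc⟩ := by
  rw [D1, mkDerivation_X, dif_neg (by simp)]
  simp; rfl

lemma D2_X_last (k : Fin n) : D2 n d (X ⟨k, Fin.last _⟩) = 0 := by
  rw [D2, mkDerivation_X, dif_pos (by rfl)]

lemma D2_X_castSucc (k : Fin n) (j : Fin (d k)) :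
    D2 n d (X ⟨k, j.castSucc⟩) = ((d k : ℂ) - j) • X ⟨k, j.succ⟩ := by
  rw [D2, mkDerivation_X, dif_neg (by simpa using j.isLt.ne)]
  simp [Nat.cast_sub j.isLt.le]; rfl

lemma Dg_X (u : Idx n d → ℂ) (x : Idx n d) : Dg u (X x) = u x • X x := by
  rw [Dg, mkDerivation_X]

lemma Dg_D1 (u : Idx n d → ℂ) (c : ℂ)
    (h : ∀ k (j : Fin (d k)), u ⟨k, j.castSucc⟩ - u ⟨k, j.succ⟩ = c)
    (f : MvPolynomial (Idx n d) ℂ) :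
    Dg u (D1 n d f) = D1 n d (Dg u f) + c • D1 n d f := by
  have : ⁅Dg u, D1 n d⁆ = c • D1 n d := by
    apply derivation_ext
    rintro ⟨k, i⟩
    rw [Derivation.commutator_apply, Derivation.smul_apply]
    refine Fin.cases ?_ (fun j => ?_) i
    · simp [D1_X_zero, Dg_X]
    · simp only [D1_X_succ, Dg_X, Derivation.map_smul, smul_smul, ← sub_smul]
      rw [← h k j]; congr 1; ring
  have h2 := congrArg (fun D => D f) this
  simp only [Derivation.commutator_apply, Derivation.smul_apply] at h2
  rw [← h2]; abel

lemma Dg_D2 (u : Idx n d → ℂ) (c : ℂ)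
    (h : ∀ k (j : Fin (d k)), u ⟨k, j.castSucc⟩ - u ⟨k, j.succ⟩ = c)
    (f : MvPolynomial (Idx n d) ℂ) :
    Dg u (D2 n d f) = D2 n d (Dg u f) - c • D2 n d f := by
  have : ⁅Dg u, D2 n d⁆ = (-c) • D2 n d := by
    apply derivation_ext
    rintro ⟨k, i⟩
    rw [Derivation.commutator_apply, Derivation.smul_apply]
    refine Fin.lastCases ?_ (fun j => ?_) i
    · simp [D2_X_last, Dg_X]
    · simp only [D2_X_castSucc, Dg_X, Derivation.map_smul, smul_smul, ← sub_smul]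
      rw [← h k j]; congr 1; ring
  have h2 := congrArg (fun D => D f) this
  simp only [Derivation.commutator_apply, Derivation.smul_apply, neg_smul] at h2
  rw [sub_eq_add_neg, ← h2]; abel

/-- The weight of a variable. -/
noncomputable def wtv (x : Idx n d) : ℂ := (d x.1 : ℂ) - 2 * ((x.2 : ℕ) : ℂ)

lemma comm_D1_D2 (f : MvPolynomial (Idx n d) ℂ) :
    D1 n d (D2 n d f) = D2 n d (D1 n d f) + Dg wtv f := by
  have : ⁅D1 n d, D2 n d⁆ = Dg wtv := by
    apply derivation_ext
    rintro ⟨k, i⟩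
    rw [Derivation.commutator_apply]
    have e1 : D1 n d (D2 n d (X ⟨k, i⟩)) = (((d k : ℂ) - (i : ℕ)) * ((i : ℕ) + 1)) • X ⟨k, i⟩ := by
      refine Fin.lastCases ?_ (fun j => ?_) i
      · simp [D2_X_last]
      · simp only [D2_X_castSucc, D1_X_succ, Derivation.map_smul, smul_smul, Fin.val_castSucc]
    have e2 : D2 n d (D1 n d (X ⟨k, i⟩)) = ((i : ℕ) * ((d k : ℂ) - (i : ℕ) + 1)) • X ⟨k, i⟩ := by
      refine Fin.cases ?_ (fun j => ?_) i
      · simp [D1_X_zero]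
      · simp only [D2_X_castSucc, D1_X_succ, Derivation.map_smul, smul_smul, Fin.val_succ]
        congr 1; push_cast; ring
    rw [e1, e2, Dg_X, ← sub_smul]
    congr 1
    simp only [wtv]; ring
  have h2 := congrArg (fun D => D f) this
  simp only [Derivation.commutator_apply] at h2
  rw [← h2]; abel

/-- Weights of the Fischer form. -/
noncomputable def fw (α : Idx n d →₀ ℕ) : ℝ :=
  ∏ x : Idx n d, ((α x).factorial : ℝ) * (((d x.1).choose x.2 : ℝ)⁻¹) ^ (α x)

lemma choose_pos' (x : Idx n d) : 0 < ((d x.1).choose x.2 : ℝ) := by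
  exact_mod_cast Nat.choose_pos (Nat.lt_succ_iff.mp x.2.isLt)

lemma fw_pos (α : Idx n d →₀ ℕ) : 0 < fw α := by
  apply Finset.prod_pos
  intro x _
  have := choose_pos' x
  positivity

lemma fw_add_single (β : Idx n d →₀ ℕ) (p : Idx n d) :
    fw (β + Finsupp.single p 1) = fw β * ((β p + 1) * ((d p.1).choose p.2 : ℝ)⁻¹) := by
  classical
  unfold fw
  rw [← Finset.mul_prod_erase _ _ (Finset.mem_univ p),
    ← Finset.mul_prod_erase (Finset.univ) (fun x : Idx n d =>
      ((β x).factorial : ℝ) * (((d x.1).choose x.2 : ℝ)⁻¹) ^ (β x)) (Finset.mem_univ p)]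
  have : ∀ x ∈ Finset.univ.erase p, (((β + Finsupp.single p 1 : Idx n d →₀ ℕ) x).factorial : ℝ) *
      (((d x.1).choose x.2 : ℝ)⁻¹) ^ ((β + Finsupp.single p 1 : Idx n d →₀ ℕ) x) =
      ((β x).factorial : ℝ) * (((d x.1).choose x.2 : ℝ)⁻¹) ^ (β x) := by
    intro x hx
    have : (Finsupp.single p 1 : Idx n d →₀ ℕ) x = 0 :=
      Finsupp.single_eq_of_ne (Finset.ne_of_mem_erase hx)
    simp [this]
  rw [Finset.prod_congr rfl this]
  simp only [Finsupp.coe_add, Pi.add_apply, Finsupp.single_eq_same, Nat.factorial_succ, pow_succ]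
  push_cast; ring

/-- The Fischer form, linear in the first argument. -/
noncomputable def FB (g : MvPolynomial (Idx n d) ℂ) : MvPolynomial (Idx n d) ℂ →ₗ[ℂ] ℂ :=
  (basisMonomials (Idx n d) ℂ).constr ℂ (fun α => (fw α : ℂ) * (starRingEnd ℂ) (coeff α g))

lemma FB_monomial (g : MvPolynomial (Idx n d) ℂ) (α : Idx n d →₀ ℕ) (c : ℂ) :
    FB g (monomial α c) = c * ((fw α : ℂ) * (starRingEnd ℂ) (coeff α g)) := by
  have : monomial α c = c • (basisMonomials (Idx n d) ℂ α) := by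
    simp [smul_monomial]
  rw [this, map_smul, FB, Module.Basis.constr_basis, smul_eq_mul]

lemma FB_self (f : MvPolynomial (Idx n d) ℂ) :
    FB f f = ((∑ α ∈ f.support, fw α * Complex.normSq (coeff α f) : ℝ) : ℂ) := by
  have : FB f f = FB f (∑ α ∈ f.support, monomial α (coeff α f)) := by
    rw [← MvPolynomial.as_sum f]
  rw [this, map_sum]
  push_cast
  refine Finset.sum_congr rfl fun α _ => ?_
  rw [FB_monomial, Complex.normSq_eq_conj_mul_self]; ring

lemma FB_self_nonneg (f : MvPolynomial (Idx n d) ℂ) : 0 ≤ (FB f f).re := by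
  rw [FB_self, Complex.ofReal_re]
  exact Finset.sum_nonneg fun α _ => mul_nonneg (fw_pos α).le (Complex.normSq_nonneg _)

lemma FB_self_eq_zero {f : MvPolynomial (Idx n d) ℂ} (h : (FB f f).re = 0) : f = 0 := by
  rw [FB_self, Complex.ofReal_re, Finset.sum_eq_zero_iff_of_nonneg
    (fun α _ => mul_nonneg (fw_pos α).le (Complex.normSq_nonneg _))] at h
  ext α
  by_cases hα : α ∈ f.support
  · have := h α hα
    rcases mul_eq_zero.mp this with h0 | h0
    · exact absurd h0 (fw_pos α).ne'
    · simpa using h0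
  · simpa using hα

lemma FB_single (p q : Idx n d) (f g : MvPolynomial (Idx n d) ℂ) :
    ((d p.1).choose p.2 : ℂ) * FB g (X p * pderiv q f) =
    ((d q.1).choose q.2 : ℂ) * FB (X q * pderiv p g) f := by
  classical
  induction f using MvPolynomial.induction_on' with
  | add a b ha hb => rw [map_add, mul_add, map_add, mul_add, ha, hb, map_add, mul_add]
  | monomial α c =>
    rw [pderiv_monomial, FB_monomial, X, monomial_mul, FB_monomial]
    by_cases hq : α q = 0
    · rw [coeff_X_mul']
      simp [hq]
    · obtain ⟨β, rfl⟩ : ∃ β, α = β + Finsupp.single q 1 :=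
        ⟨α - Finsupp.single q 1, (tsub_add_cancel_of_le
          (by simpa using Nat.one_le_iff_ne_zero.mpr hq)).symm⟩
      rw [add_tsub_cancel_right, add_comm (Finsupp.single p 1) β, add_comm β (Finsupp.single q 1),
        coeff_X_mul, coeff_pderiv, add_comm (Finsupp.single q 1) β, fw_add_single, fw_add_single]
      have hp' : ((d p.1).choose p.2 : ℂ) ≠ 0 := by exact_mod_cast (choose_pos' p).ne'
      have hq' : ((d q.1).choose q.2 : ℂ) ≠ 0 := by exact_mod_cast (choose_pos' q).ne'
      simp
      field_simp

lemma FB_adj (f g : MvPolynomial (Idx n d) ℂ) : FB g (D1 n d f) = FB (D2 n d g) f := by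
  have hadd : ∀ a b f : MvPolynomial (Idx n d) ℂ, FB (a + b) f = FB a f + FB b f := by
    intro a b f
    induction f using MvPolynomial.induction_on' with
    | add p q hp hq => rw [map_add, map_add, map_add, hp, hq]; ring
    | monomial α c => simp only [FB_monomial, coeff_add, map_add]; ring
  have hz : ∀ f : MvPolynomial (Idx n d) ℂ, FB 0 f = 0 := by
    intro f
    have := hadd 0 0 f
    simpa using this
  have hsum : ∀ {ι : Type} (s : Finset ι) (a : ι → MvPolynomial (Idx n d) ℂ) f,
      FB (∑ i ∈ s, a i) f = ∑ i ∈ s, FB (a i) f := by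
    classical
    intro ι s a f
    induction s using Finset.induction_on with
    | empty => simp [hz]
    | insert i s hi ih => rw [Finset.sum_insert hi, Finset.sum_insert hi, hadd, ih]
  have hsmul : ∀ (c : ℝ) (a f : MvPolynomial (Idx n d) ℂ), FB ((c : ℂ) • a) f = c * FB a f := by
    intro c a f
    induction f using MvPolynomial.induction_on' with
    | add p q hp hq => rw [map_add, map_add, hp, hq]; ring
    | monomial α c => simp only [FB_monomial, coeff_smul, smul_eq_mul, map_mul, Complex.conj_ofReal]; ring
  rw [D1_eq, D2_eq]
  simp only [der_sum, Derivation.smul_apply, map_sum, hsum, map_smul,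
    smul_eq_mul]
  refine Finset.sum_congr rfl fun k _ => Finset.sum_congr rfl fun j _ => ?_
  have h1 := FB_single (⟨k, j.castSucc⟩ : Idx n d) ⟨k, j.succ⟩ f g
  have h2 : ((d k : ℂ) - j) = (((d k : ℝ) - (j : ℕ) : ℝ) : ℂ) := by push_cast; rfl
  rw [h2, hsmul, ← h2]
  have hc : ((d k).choose (j + 1) : ℂ) * (j + 1) = (d k).choose j * ((d k : ℂ) - j) := by
    have := Nat.choose_succ_right_eq (d k) j
    rw [← Nat.cast_sub j.isLt.le]
    exact_mod_cast this
  have hp' : ((d k).choose j : ℂ) ≠ 0 := by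
    exact_mod_cast (Nat.choose_pos j.isLt.le).ne'
  simp only [Fin.val_castSucc, Fin.val_succ] at h1
  apply mul_left_cancel₀ hp'
  linear_combination ((j : ℂ) + 1) * h1 + FB (X ⟨k, j.succ⟩ * pderiv (⟨k, j.castSucc⟩ : Idx n d) g) f * hc

end SlTwo

section SlTwoDim

variable {n : ℕ} {d : Fin n → ℕ}

lemma Dg_eq_smul_iff (u : Idx n d → ℂ) (c : ℂ) (f : MvPolynomial (Idx n d) ℂ) :
    Dg u f = c • f ↔ ∀ α ∈ f.support, (∑ x, u x * α x) = c := by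
  rw [MvPolynomial.ext_iff]
  constructor
  · intro h α hα
    have := h α
    rw [coeff_Dg, coeff_smul, smul_eq_mul] at this
    exact mul_right_cancel₀ (mem_support_iff.mp hα) this
  · intro h α
    rw [coeff_Dg, coeff_smul, smul_eq_mul]
    by_cases hα : α ∈ f.support
    · rw [h α hα]
    · rw [notMem_support_iff.mp hα]; simp

lemma mem_mdeg_iff_s14 (m : Fin n → ℕ) (f : MvPolynomial (Idx n d) ℂ) :
    f ∈ mdeg n d m ↔ ∀ k, Dg (fun x => if x.1 = k then 1 else 0) f = (m k : ℂ) • f := by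
  have key : ∀ (α : Idx n d →₀ ℕ) (k : Fin n),
      (∑ x : Idx n d, (if x.1 = k then (1 : ℂ) else 0) * α x) = ((∑ j, α ⟨k, j⟩ : ℕ) : ℂ) := by
    intro α k
    rw [Fintype.sum_sigma, Finset.sum_eq_single k]
    · simp
    · intro l _ hl; simp [hl]
    · simp
  change (∀ α ∈ f.support, ∀ k : Fin n, (∑ j : Fin (d k + 1), α ⟨k, j⟩) = m k) ↔ _
  simp only [Dg_eq_smul_iff, key, Nat.cast_inj]
  exact ⟨fun h k α hα => h α hα k, fun h α hα k => h k α hα⟩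

/-- Exponents of multidegree `m` and weight `i`. -/
def WS (n : ℕ) (d : Fin n → ℕ) (m : Fin n → ℕ) (i : ℤ) : Set (Idx n d →₀ ℕ) :=
  {α | (∀ k, ∑ j : Fin (d k + 1), α ⟨k, j⟩ = m k) ∧
    (∑ k : Fin n, ∑ j : Fin (d k + 1), ((d k : ℤ) - 2 * (j : ℕ)) * (α ⟨k, j⟩ : ℤ)) = i}

lemma mem_W_iff (m : Fin n → ℕ) (i : ℤ) (f : MvPolynomial (Idx n d) ℂ) :
    f ∈ restrictSupport ℂ (WS n d m i) ↔ f ∈ mdeg n d m ∧ Dg wtv f = (i : ℂ) • f := by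
  have key : ∀ (α : Idx n d →₀ ℕ), (∑ x : Idx n d, wtv x * (α x : ℂ)) =
      ((∑ k : Fin n, ∑ j : Fin (d k + 1), ((d k : ℤ) - 2 * (j : ℕ)) * (α ⟨k, j⟩ : ℤ) : ℤ) : ℂ) := by
    intro α
    rw [Fintype.sum_sigma]
    push_cast
    rfl
  rw [mem_restrictSupport_iff, Dg_eq_smul_iff]
  simp only [key, Int.cast_inj]
  constructor
  · intro h
    exact ⟨fun α hα => (h hα).1, fun α hα => (h hα).2⟩
  · intro h α hα
    exact ⟨h.1 α hα, h.2 α hα⟩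

lemma D1_mem_mdeg (m : Fin n → ℕ) {f : MvPolynomial (Idx n d) ℂ} (hf : f ∈ mdeg n d m) :
    D1 n d f ∈ mdeg n d m := by
  rw [mem_mdeg_iff_s14] at *
  intro k
  rw [Dg_D1 _ 0 (by simp), hf k, Derivation.map_smul]; simp

lemma D2_mem_mdeg (m : Fin n → ℕ) {f : MvPolynomial (Idx n d) ℂ} (hf : f ∈ mdeg n d m) :
    D2 n d f ∈ mdeg n d m := by
  rw [mem_mdeg_iff_s14] at *
  intro k
  rw [Dg_D2 _ 0 (by simp), hf k, Derivation.map_smul]; simp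

lemma wtv_step (k : Fin n) (j : Fin (d k)) :
    (wtv ⟨k, j.castSucc⟩ - wtv ⟨k, j.succ⟩ : ℂ) = 2 := by
  simp [wtv]; ring

lemma D1_mem_W (m : Fin n → ℕ) {f : MvPolynomial (Idx n d) ℂ}
    (hf : f ∈ restrictSupport ℂ (WS n d m 0)) : D1 n d f ∈ restrictSupport ℂ (WS n d m 2) := by
  rw [mem_W_iff] at *
  refine ⟨D1_mem_mdeg m hf.1, ?_⟩
  rw [Dg_D1 _ 2 wtv_step, hf.2]; simp

lemma D2_mem_W (m : Fin n → ℕ) {f : MvPolynomial (Idx n d) ℂ}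
    (hf : f ∈ restrictSupport ℂ (WS n d m 2)) : D2 n d f ∈ restrictSupport ℂ (WS n d m 0) := by
  rw [mem_W_iff] at *
  refine ⟨D2_mem_mdeg m hf.1, ?_⟩
  rw [Dg_D2 _ 2 wtv_step, hf.2, Derivation.map_smul]; simp

lemma WS_finite (m : Fin n → ℕ) (i : ℤ) : (WS n d m i).Finite := by
  have : (WS n d m i) ⊆ {α | α ≤ Finsupp.equivFunOnFinite.symm (fun x : Idx n d => m x.1)} := by
    intro α hα x
    have := hα.1 x.1
    simp only [Finsupp.equivFunOnFinite_symm_apply_apply]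
    rw [← this]
    exact Finset.single_le_sum (f := fun j => α ⟨x.1, j⟩) (fun _ _ => Nat.zero_le _) (Finset.mem_univ x.2)
  exact (Set.finite_Iic _).subset this

lemma finrank_W (m : Fin n → ℕ) (i : ℤ) :
    Module.finrank ℂ (restrictSupport ℂ (WS n d m i)) = omegaCount n d m i := by
  rw [Module.finrank_eq_nat_card_basis (basisRestrictSupport ℂ (WS n d m i)), omegaCount]
  exact Nat.card_congr (Finsupp.equivFunOnFinite.subtypeEquiv (fun α => Iff.rfl))

lemma D2_inj {f : MvPolynomial (Idx n d) ℂ} (hf : Dg wtv f = (2 : ℂ) • f) (h : D2 n d f = 0) :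
    f = 0 := by
  have h1 := comm_D1_D2 f
  rw [h, map_zero, hf] at h1
  have h2 : D2 n d (D1 n d f) = (-2 : ℂ) • f := by
    rw [neg_smul]; exact eq_neg_of_add_eq_zero_left h1.symm
  have h3 := FB_adj f (D1 n d f)
  have h5 : FB ((-2 : ℂ) • f) f = -2 * FB f f := by
    rw [FB_self, FB]
    have : FB ((-2 : ℂ) • f) f = FB ((-2 : ℂ) • f) (∑ α ∈ f.support, monomial α (coeff α f)) := by
      rw [← MvPolynomial.as_sum f]
    change FB ((-2 : ℂ) • f) f = _
    rw [this, map_sum]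
    push_cast
    rw [Finset.mul_sum]
    refine Finset.sum_congr rfl fun α _ => ?_
    rw [FB_monomial, Complex.normSq_eq_conj_mul_self, coeff_smul]
    have h22 : (starRingEnd ℂ) 2 = 2 := Complex.conj_ofNat 2
    simp [h22]; ring
  rw [h2, h5] at h3
  have h4 := FB_self_nonneg (D1 n d f)
  have h6 := FB_self_nonneg f
  rw [h3] at h4
  apply FB_self_eq_zero
  simp at h4
  linarith

lemma finrank_inv (m : Fin n → ℕ) :
    (Module.finrank ℂ ↥(mdeg n d m ⊓ LinearMap.ker (D1 n d).toLinearMap ⊓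
        LinearMap.ker (D2 n d).toLinearMap) : ℤ) = omegaCount n d m 0 - omegaCount n d m 2 := by
  have : Finite (WS n d m 0) := WS_finite m 0
  have : Finite (WS n d m 2) := WS_finite m 2
  have f0 : Module.Finite ℂ (restrictSupport ℂ (WS n d m 0)) :=
    Module.Finite.of_basis (basisRestrictSupport ℂ (WS n d m 0))
  have f2 : Module.Finite ℂ (restrictSupport ℂ (WS n d m 2)) :=
    Module.Finite.of_basis (basisRestrictSupport ℂ (WS n d m 2))
  let T : restrictSupport ℂ (WS n d m 0) →ₗ[ℂ] restrictSupport ℂ (WS n d m 2) :=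
    (D1 n d).toLinearMap.restrict (fun f hf => D1_mem_W m hf)
  let T' : restrictSupport ℂ (WS n d m 2) →ₗ[ℂ] restrictSupport ℂ (WS n d m 0) :=
    (D2 n d).toLinearMap.restrict (fun f hf => D2_mem_W m hf)
  have hinj : Function.Injective (T ∘ₗ T') := by
    rw [← LinearMap.ker_eq_bot, LinearMap.ker_eq_bot']
    rintro ⟨f, hf⟩ h
    have h' : D1 n d (D2 n d f) = 0 := congrArg Subtype.val h
    have h1 := FB_adj (D2 n d f) f
    rw [h', map_zero] at h1
    have h2 : D2 n d f = 0 := FB_self_eq_zero (by rw [← h1]; simp)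
    have := D2_inj (by simpa using ((mem_W_iff m 2 f).mp hf).2) h2
    exact Subtype.ext this
  have hsurj : Function.Surjective T := by
    have := LinearMap.injective_iff_surjective.mp hinj
    intro y
    obtain ⟨x, hx⟩ := this y
    exact ⟨T' x, hx⟩
  have hr := LinearMap.finrank_range_add_finrank_ker T
  rw [LinearMap.range_eq_top.mpr hsurj, finrank_top, finrank_W, finrank_W] at hr
  have hI : (mdeg n d m ⊓ LinearMap.ker (D1 n d).toLinearMap ⊓
        LinearMap.ker (D2 n d).toLinearMap) = (LinearMap.ker T).map (Submodule.subtype _) := by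
    ext f
    simp only [Submodule.mem_inf, LinearMap.mem_ker, Submodule.mem_map, Submodule.subtype_apply,
      Subtype.exists, exists_and_right, exists_eq_right]
    constructor
    · rintro ⟨⟨h1, h2⟩, h3⟩
      have h2' : D1 n d f = 0 := h2
      have h3' : D2 n d f = 0 := h3
      have hc := comm_D1_D2 f
      rw [h2', h3', map_zero, map_zero, zero_add] at hc
      exact ⟨(mem_W_iff m 0 f).mpr ⟨h1, by rw [← hc]; simp⟩, Subtype.ext h2⟩
    · rintro ⟨h1, h2⟩
      have h2' : D1 n d f = 0 := congrArg Subtype.val h2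
      have hw := (mem_W_iff m 0 f).mp h1
      refine ⟨⟨hw.1, h2'⟩, ?_⟩
      have hc := comm_D1_D2 f
      rw [h2', map_zero, zero_add, hw.2] at hc
      have h3 := FB_adj (D2 n d f) f
      rw [hc] at h3
      have h4 : D2 n d f = 0 := FB_self_eq_zero (by rw [← h3]; simp)
      exact h4
  rw [hI, Submodule.finrank_map_subtype_eq]
  omega

end SlTwoDim

section Series

open LaurentPolynomial in
lemma coeff_T_neg_two_mul (q : ℤ[T;T⁻¹]) (μ : ℤ) :
    (T (-2) * q).coeff μ = q.coeff (μ + 2) := by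
  rw [T, AddMonoidAlgebra.coeff_single_mul_apply]
  simp [add_comm]

/-- geometric series -/
noncomputable def geo {R : Type*} [CommRing R] (a : R) : PowerSeries R := PowerSeries.mk (fun n => a ^ n)

lemma geo_mul {R : Type*} [CommRing R] (a : R) :
    geo a * (1 - PowerSeries.C a * PowerSeries.X) = 1 := by
  ext n
  rw [mul_sub, mul_one, ← mul_assoc, map_sub]
  cases n with
  | zero => simp [geo]
  | succ n =>
    rw [PowerSeries.coeff_succ_mul_X, PowerSeries.coeff_mul_C, geo, PowerSeries.coeff_mk,
      PowerSeries.coeff_mk, PowerSeries.coeff_one]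
    simp [pow_succ]

/-- Numerator. -/
noncomputable def numP : PowerSeries (Polynomial ℤ) :=
  1 + (PowerSeries.C Polynomial.X) ^ 2 * PowerSeries.X ^ 2 - PowerSeries.C Polynomial.X * PowerSeries.X

/-- Denominator. -/
noncomputable def denP : PowerSeries (Polynomial ℤ) :=
  (1 - PowerSeries.X ^ 4) * (1 - (PowerSeries.C Polynomial.X) ^ 3 * PowerSeries.X) *
    (1 - PowerSeries.C Polynomial.X * PowerSeries.X)

/-- The series as a power series over polynomials. -/
noncomputable def serU : PowerSeries (Polynomial ℤ) := numP * PowerSeries.invOfUnit denP 1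

lemma serU_mul : serU * denP = numP := by
  rw [serU, mul_assoc, mul_comm (PowerSeries.invOfUnit _ _), PowerSeries.mul_invOfUnit, mul_one]
  simp [denP]

open LaurentPolynomial in
/-- Generating function of the weights of the cubic. -/
noncomputable def serQ : PowerSeries (ℤ[T;T⁻¹]) := ∏ j : Fin 4, geo (T (3 - 2 * ((j : ℕ) : ℤ)))

open LaurentPolynomial in
lemma serQ_eq : serQ = geo (T 3) * geo (T 1) * geo (T (-1)) * geo (T (-3)) := by
  rw [serQ, Fin.prod_univ_four]
  norm_num

open LaurentPolynomial in
lemma map_invert_geo (k : ℤ) : PowerSeries.map (invert (R := ℤ)).toRingEquiv.toRingHom (geo (T k)) = geo (T (-k)) := by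
  ext n : 1
  simp [geo]

open LaurentPolynomial in
lemma map_invert_serQ : PowerSeries.map (invert (R := ℤ)).toRingEquiv.toRingHom serQ = serQ := by
  rw [serQ_eq, map_mul, map_mul, map_mul]
  simp only [map_invert_geo, neg_neg]
  ring

open LaurentPolynomial in
lemma serQ_symm (m : ℕ) (μ : ℤ) : (PowerSeries.coeff m serQ).coeff (-μ) = (PowerSeries.coeff m serQ).coeff μ := by
  conv_rhs => rw [← map_invert_serQ]
  rw [PowerSeries.coeff_map]
  exact (invert_apply _ _).symm

open LaurentPolynomial in
lemma key_identity :
    (1 - PowerSeries.C (T (-2))) * serQ = PowerSeries.map (Polynomial.toLaurent (R := ℤ)) serU -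
      PowerSeries.C (T (-2)) * PowerSeries.map (invert (R := ℤ)).toRingEquiv.toRingHom
        (PowerSeries.map (Polynomial.toLaurent (R := ℤ)) serU) := by
  set UL := PowerSeries.map (Polynomial.toLaurent (R := ℤ)) serU with hUL
  set VL := PowerSeries.map (invert (R := ℤ)).toRingEquiv.toRingHom UL with hVL
  set t : PowerSeries (ℤ[T;T⁻¹]) := PowerSeries.C (T 1) with ht
  set u : PowerSeries (ℤ[T;T⁻¹]) := PowerSeries.C (T (-1)) with hu
  set z : PowerSeries (ℤ[T;T⁻¹]) := PowerSeries.X with hz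
  have htu : t * u = 1 := by rw [ht, hu, ← map_mul, ← T_add]; simp
  have e1 : UL * ((1 - z ^ 4) * (1 - t ^ 3 * z) * (1 - t * z)) = 1 + t ^ 2 * z ^ 2 - t * z := by
    have := congrArg (PowerSeries.map (Polynomial.toLaurent (R := ℤ))) serU_mul
    simpa [numP, denP, map_mul, map_sub, map_add, map_pow] using this
  have e2 : VL * ((1 - z ^ 4) * (1 - u ^ 3 * z) * (1 - u * z)) = 1 + u ^ 2 * z ^ 2 - u * z := by
    have := congrArg (PowerSeries.map (invert (R := ℤ)).toRingEquiv.toRingHom) e1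
    simpa [hVL, hu, ht, hz, map_mul, map_sub, map_add, map_pow] using this
  have ht3 : PowerSeries.C (T 3 : ℤ[T;T⁻¹]) = t ^ 3 := by
    rw [ht, ← map_pow, T_pow]; norm_num
  have hu3 : PowerSeries.C (T (-3) : ℤ[T;T⁻¹]) = u ^ 3 := by
    rw [hu, ← map_pow, T_pow]; norm_num
  have hu2 : PowerSeries.C (T (-2) : ℤ[T;T⁻¹]) = u ^ 2 := by
    rw [hu, ← map_pow, T_pow]; norm_num
  have e3 : serQ * ((1 - t ^ 3 * z) * (1 - t * z) * (1 - u * z) * (1 - u ^ 3 * z)) = 1 := by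
    have g1 := geo_mul (T 3 : ℤ[T;T⁻¹])
    have g2 := geo_mul (T 1 : ℤ[T;T⁻¹])
    have g3 := geo_mul (T (-1) : ℤ[T;T⁻¹])
    have g4 := geo_mul (T (-3) : ℤ[T;T⁻¹])
    rw [ht3] at g1
    rw [hu3] at g4
    calc _ = (geo (T 3) * (1 - t ^ 3 * z)) * (geo (T 1) * (1 - t * z)) *
        (geo (T (-1)) * (1 - u * z)) * (geo (T (-3)) * (1 - u ^ 3 * z)) := by
          rw [serQ_eq]; ring
      _ = 1 := by rw [g1, g2, g3, g4]; simp
  rw [hu2]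
  have hP : IsUnit ((1 - z ^ 4) * (1 - t ^ 3 * z) * (1 - t * z) * (1 - u * z) * (1 - u ^ 3 * z)) := by
    rw [PowerSeries.isUnit_iff_constantCoeff]
    simp [hz]
  apply hP.mul_right_cancel
  linear_combination (1 - u ^ 2) * (1 - z ^ 4) * e3 - (1 - u * z) * (1 - u ^ 3 * z) * e1 +
    u ^ 2 * (1 - t * z) * (1 - t ^ 3 * z) * e2 + ((-1) * t ^ 0 * u ^ 2 * z ^ 4 + (-1) * t ^ 1 * u ^ 3 * z ^ 4 + (-1) * t ^ 0 * u ^ 1 * z ^ 1 + (-1) * t ^ 1 * u ^ 0 * z ^ 1 + (-1) * t ^ 2 * u ^ 1 * z ^ 1 + (1) * t ^ 2 * u ^ 0 * z ^ 2 + (1) * t ^ 3 * u ^ 1 * z ^ 2 + (1) * t ^ 1 * u ^ 1 * z ^ 2 + (1) * t ^ 2 * u ^ 2 * z ^ 2 + (-1) * t ^ 2 * u ^ 1 * z ^ 3 + (-1) * t ^ 3 * u ^ 2 * z ^ 3 + (-1) * t ^ 2 * u ^ 3 * z ^ 3 + (1) * t ^ 0 * u ^ 0 * z ^ 4 + (1)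 * t ^ 1 * u ^ 1 * z ^ 4 + (1) * t ^ 2 * u ^ 2 * z ^ 4 + (1) * t ^ 3 * u ^ 3 * z ^ 4) * htu

open LaurentPolynomial in
lemma toLaurent_coeff_nat (p : Polynomial ℤ) (k : ℕ) :
    (Polynomial.toLaurent p).coeff (k : ℤ) = p.coeff k := by
  rw [coeff_toLaurent]
  exact Finsupp.mapDomain_apply Nat.cast_injective _ _

open LaurentPolynomial in
lemma toLaurent_coeff_neg (p : Polynomial ℤ) (k : ℤ) (hk : k < 0) :
    (Polynomial.toLaurent p).coeff k = 0 := by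
  rw [coeff_toLaurent]
  refine Finsupp.mapDomain_of_notMem_range _ _ ?_
  rintro ⟨n, hn⟩
  have : (n : ℤ) = k := hn
  omega

open LaurentPolynomial in
lemma serQ_diff (m μ : ℕ) : (PowerSeries.coeff m serQ).coeff (μ : ℤ) -
    (PowerSeries.coeff m serQ).coeff ((μ : ℤ) + 2) = (PowerSeries.coeff m serU).coeff μ := by
  have h := congrArg (fun A => (PowerSeries.coeff m A).coeff (μ : ℤ)) key_identity
  simp only [sub_mul, one_mul, map_sub, PowerSeries.coeff_C_mul, PowerSeries.coeff_map] at h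
  have h0 : (Polynomial.toLaurent (PowerSeries.coeff m serU)).coeff (μ : ℤ) =
      (PowerSeries.coeff m serU).coeff μ := toLaurent_coeff_nat _ _
  have h1 : ((invert (R := ℤ)).toRingEquiv.toRingHom
      (Polynomial.toLaurent (PowerSeries.coeff m serU))).coeff ((μ : ℤ) + 2) = 0 :=
    (invert_apply _ _).trans (toLaurent_coeff_neg _ _ (by omega))
  have h2 : ∀ a b : ℤ[T;T⁻¹], ∀ k : ℤ, (a - b).coeff k = a.coeff k - b.coeff k := fun a b k => rfl
  rw [h2, h2, coeff_T_neg_two_mul, coeff_T_neg_two_mul, h0, h1, sub_zero] at h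
  exact h

end Series

section Transfer

/-- Bivariate power series attached to a power series over polynomials. -/
noncomputable def Phi (A : PowerSeries (Polynomial ℤ)) : MvPowerSeries (Fin 2) ℤ :=
  fun n => (PowerSeries.coeff (n 1) A).coeff (n 0)

lemma coeff_Phi (A : PowerSeries (Polynomial ℤ)) (n : Fin 2 →₀ ℕ) :
    MvPowerSeries.coeff n (Phi A) = (PowerSeries.coeff (n 1) A).coeff (n 0) := rfl

/-- Compatibility of the two multiplications. -/
def MulRel (B : PowerSeries (Polynomial ℤ)) (B' : MvPowerSeries (Fin 2) ℤ) : Prop :=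
  ∀ A, Phi (A * B) = Phi A * B'

lemma Phi_add (A B) : Phi (A + B) = Phi A + Phi B := by
  ext n; simp [coeff_Phi]

lemma Phi_sub (A B) : Phi (A - B) = Phi A - Phi B := by
  ext n; simp [coeff_Phi]

lemma MulRel.one : MulRel 1 1 := fun A => by simp

lemma MulRel.mul {B C B' C'} (h : MulRel B B') (k : MulRel C C') : MulRel (B * C) (B' * C') := fun A => by
  rw [← mul_assoc, k, h, mul_assoc]

lemma MulRel.add {B C B' C'} (h : MulRel B B') (k : MulRel C C') : MulRel (B + C) (B' + C') := fun A => by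
  rw [mul_add, Phi_add, k, h, mul_add]

lemma MulRel.sub {B C B' C'} (h : MulRel B B') (k : MulRel C C') : MulRel (B - C) (B' - C') := fun A => by
  rw [mul_sub, Phi_sub, k, h, mul_sub]

lemma MulRel.pow {B B'} (h : MulRel B B') (k : ℕ) : MulRel (B ^ k) (B' ^ k) := by
  induction k with
  | zero => simpa using MulRel.one
  | succ k ih => rw [pow_succ, pow_succ]; exact ih.mul h

lemma MulRel.z0 : MulRel (PowerSeries.C Polynomial.X) (MvPowerSeries.X 0) := fun A => by
  ext n
  rw [coeff_Phi, MvPowerSeries.X, MvPowerSeries.coeff_mul_monomial, PowerSeries.coeff_mul_C,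
    coeff_Phi, mul_one]
  have h : Finsupp.single (0 : Fin 2) 1 ≤ n ↔ 1 ≤ n 0 := by simp
  rcases hn : n 0 with _ | k
  · rw [if_neg (by rw [h]; omega)]; simp
  · rw [if_pos (by rw [h]; omega)]; simp [hn]

lemma MulRel.z1 : MulRel PowerSeries.X (MvPowerSeries.X 1) := fun A => by
  ext n
  rw [coeff_Phi, MvPowerSeries.X, MvPowerSeries.coeff_mul_monomial,
    coeff_Phi, mul_one]
  have h : Finsupp.single (1 : Fin 2) 1 ≤ n ↔ 1 ≤ n 1 := by simp
  rcases hn : n 1 with _ | k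
  · rw [if_neg (by rw [h]; omega)]; simp
  · rw [if_pos (by rw [h]; omega)]; simp [hn, PowerSeries.coeff_succ_mul_X]

lemma Phi_one : Phi 1 = 1 := by
  ext n
  rw [coeff_Phi, PowerSeries.coeff_one, MvPowerSeries.coeff_one]
  by_cases h1 : n 1 = 0
  · by_cases h0 : n 0 = 0
    · have : n = 0 := by ext i; fin_cases i <;> simp [h0, h1]
      simp [this]
    · have : n ≠ 0 := by rintro rfl; simp at h0
      simp [this, h1, Polynomial.coeff_one, h0]
  · have : n ≠ 0 := by rintro rfl; simp at h1
    simp [this, h1]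

lemma transfer (n : Fin 2 →₀ ℕ) :
    MvPowerSeries.coeff (R := ℤ) n
        ((1 + MvPowerSeries.X (0 : Fin 2) ^ 2 * MvPowerSeries.X 1 ^ 2 -
            MvPowerSeries.X 0 * MvPowerSeries.X 1) *
         MvPowerSeries.invOfUnit
          ((1 - MvPowerSeries.X (1 : Fin 2) ^ 4) *
           (1 - MvPowerSeries.X (0 : Fin 2) ^ 3 * MvPowerSeries.X 1) *
           (1 - MvPowerSeries.X (0 : Fin 2) * MvPowerSeries.X 1)) 1) =
      (PowerSeries.coeff (n 1) serU).coeff (n 0) := by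
  have hnum : MulRel numP (1 + MvPowerSeries.X (0 : Fin 2) ^ 2 * MvPowerSeries.X 1 ^ 2 -
            MvPowerSeries.X 0 * MvPowerSeries.X 1) :=
    (MulRel.one.add ((MulRel.z0.pow 2).mul (MulRel.z1.pow 2))).sub (MulRel.z0.mul MulRel.z1)
  have hden : MulRel denP ((1 - MvPowerSeries.X (1 : Fin 2) ^ 4) *
           (1 - MvPowerSeries.X (0 : Fin 2) ^ 3 * MvPowerSeries.X 1) *
           (1 - MvPowerSeries.X (0 : Fin 2) * MvPowerSeries.X 1)) :=
    ((MulRel.one.sub (MulRel.z1.pow 4)).mul (MulRel.one.sub ((MulRel.z0.pow 3).mul MulRel.z1))).mul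
      (MulRel.one.sub (MulRel.z0.mul MulRel.z1))
  have h1 := hnum 1
  rw [one_mul, Phi_one, one_mul] at h1
  have h2 := hden serU
  rw [serU_mul, h1] at h2
  rw [h2, mul_assoc, MvPowerSeries.mul_invOfUnit, mul_one, coeff_Phi]
  simp

end Transfer

section Counting

/-- number of exponents for the cubic -/
lemma serQ_coeff (m : ℕ) (μ : ℤ) :
    (PowerSeries.coeff m serQ).coeff μ =
      (((Finset.univ : Finset (Fin 4)).finsuppAntidiag m).filter
        (fun β => ∑ j : Fin 4, (3 - 2 * ((j : ℕ) : ℤ)) * (β j : ℤ) = μ)).card := by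
  rw [serQ, PowerSeries.coeff_prod]
  have h : ∀ β : Fin 4 →₀ ℕ, (∏ j : Fin 4, PowerSeries.coeff (β j)
      (geo (LaurentPolynomial.T (R := ℤ) (3 - 2 * ((j : ℕ) : ℤ))))) =
      LaurentPolynomial.T (∑ j : Fin 4, (3 - 2 * ((j : ℕ) : ℤ)) * (β j : ℤ)) := by
    intro β
    simp only [geo, PowerSeries.coeff_mk, LaurentPolynomial.T_pow, Fin.prod_univ_four,
      ← LaurentPolynomial.T_add, Fin.sum_univ_four]
    congr 1
    ring
  rw [Finset.sum_congr rfl (fun β _ => h β), Finset.card_filter]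
  push_cast
  rw [show ∀ (s : Finset (Fin 4 →₀ ℕ)) (f : (Fin 4 →₀ ℕ) → LaurentPolynomial ℤ),
    (∑ b ∈ s, f b).coeff μ = ∑ b ∈ s, (f b).coeff μ from ?_]
  · refine Finset.sum_congr rfl fun β _ => ?_
    rw [LaurentPolynomial.T]
    exact Finsupp.single_apply
  · intro s f
    classical
    induction s using Finset.induction_on with
    | empty => simp
    | insert a s ha ih => rw [Finset.sum_insert ha, Finset.sum_insert ha, ← ih]; rfl

lemma omega_cond (m₁ m₂ : ℕ) (lam : ℤ) (α : Idx 2 ![1, 3] → ℕ) :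
    ((∀ k : Fin 2, (∑ j : Fin (![1, 3] k + 1), α ⟨k, j⟩) = ![m₁, m₂] k) ∧
    (∑ k : Fin 2, ∑ j : Fin (![1, 3] k + 1),
      (((![1, 3] : Fin 2 → ℕ) k : ℤ) - 2 * (j : ℕ)) * (α ⟨k, j⟩ : ℤ)) = lam) ↔
    (α ⟨0, (0 : Fin 2)⟩ + α ⟨0, (1 : Fin 2)⟩ = m₁ ∧
      ∑ j : Fin 4, α ⟨1, j⟩ = m₂ ∧
      ∑ j : Fin 4, (3 - 2 * ((j : ℕ) : ℤ)) * (α ⟨1, j⟩ : ℤ) =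
        lam - α ⟨0, (0 : Fin 2)⟩ + α ⟨0, (1 : Fin 2)⟩) := by
  have e0 : (∑ j : Fin (![1, 3] (0 : Fin 2) + 1), α ⟨0, j⟩) =
    α ⟨0, (0 : Fin 2)⟩ + α ⟨0, (1 : Fin 2)⟩ := Fin.sum_univ_two (fun j : Fin 2 => α ⟨0, j⟩)
  have e1 : (∑ j : Fin (![1, 3] (1 : Fin 2) + 1), α ⟨1, j⟩) = ∑ j : Fin 4, α ⟨1, j⟩ := rfl
  have e2 : (∑ j : Fin (![1, 3] (0 : Fin 2) + 1),
      (((![1, 3] : Fin 2 → ℕ) 0 : ℤ) - 2 * (j : ℕ)) * (α ⟨0, j⟩ : ℤ)) =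
      (α ⟨0, (0 : Fin 2)⟩ : ℤ) - α ⟨0, (1 : Fin 2)⟩ := by
    refine (Fin.sum_univ_two (fun j : Fin 2 =>
      (((1 : ℕ) : ℤ) - 2 * ((j : ℕ) : ℤ)) * (α ⟨0, j⟩ : ℤ))).trans ?_
    simp
    ring
  have e3 : (∑ j : Fin (![1, 3] (1 : Fin 2) + 1),
      (((![1, 3] : Fin 2 → ℕ) 1 : ℤ) - 2 * (j : ℕ)) * (α ⟨1, j⟩ : ℤ)) =
      ∑ j : Fin 4, (3 - 2 * ((j : ℕ) : ℤ)) * (α ⟨1, j⟩ : ℤ) := rfl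
  rw [Fin.forall_fin_two, Fin.sum_univ_two, e0, e1, e2, e3, and_assoc]
  refine and_congr Iff.rfl (and_congr Iff.rfl ?_)
  constructor <;> intro h <;> linarith

lemma Idx_ext {α β : Idx 2 ![1, 3] → ℕ} (h0 : α ⟨0, (0 : Fin 2)⟩ = β ⟨0, (0 : Fin 2)⟩)
    (h1 : α ⟨0, (1 : Fin 2)⟩ = β ⟨0, (1 : Fin 2)⟩)
    (h : ∀ j : Fin 4, α ⟨1, j⟩ = β ⟨1, j⟩) : α = β := by
  funext x
  obtain ⟨k, j⟩ := x
  revert j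
  revert k
  refine Fin.forall_fin_two.2 ⟨?_, h⟩
  exact (Fin.forall_fin_two (p := fun j : Fin 2 => α ⟨0, j⟩ = β ⟨0, j⟩)).2 ⟨h0, h1⟩

/-- Assemble a family of exponents. -/
def mkIdx (a b : ℕ) (c : Fin 4 → ℕ) : Idx 2 ![1, 3] → ℕ :=
  fun x => if x.1 = 0 then (if x.2.1 = 0 then a else b) else c ⟨x.2.1, by
    obtain ⟨k, j⟩ := x
    revert j
    revert k
    refine Fin.forall_fin_two.2 ⟨fun j => lt_trans j.2 (by simp), fun j => j.2⟩⟩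

lemma omega_coeff (m₁ m₂ : ℕ) (lam : ℤ) :
    (omegaCount 2 ![1, 3] ![m₁, m₂] lam : ℤ) =
      ∑ i ∈ Finset.range (m₁ + 1), (PowerSeries.coeff m₂ serQ).coeff (lam - m₁ + 2 * i) := by
  simp only [serQ_coeff]
  rw [← Nat.cast_sum, ← Finset.card_sigma, Nat.cast_inj, omegaCount, ← Fintype.card_coe,
    ← Nat.card_eq_fintype_card]
  simp only [omega_cond]
  refine Nat.card_eq_of_bijective (fun α => ⟨⟨α.1 ⟨0, (1 : Fin 2)⟩,
    Finsupp.equivFunOnFinite.symm (fun j : Fin 4 => α.1 ⟨1, j⟩)⟩, ?_⟩) ⟨?_, ?_⟩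
  · obtain ⟨α, h1, h2, h3⟩ := α
    simp only [Finset.mem_sigma, Finset.mem_range, Finset.mem_filter, Finset.mem_finsuppAntidiag]
    refine ⟨by omega, ⟨h2, Finset.subset_univ _⟩, ?_⟩
    refine Eq.trans h3 ?_
    rw [← h1]
    push_cast
    ring
  · rintro ⟨α, h1, h2, h3⟩ ⟨β, k1, k2, k3⟩ h
    rw [Subtype.mk.injEq, Sigma.mk.injEq] at h
    obtain ⟨ha, hb⟩ := h
    have hb' := Finsupp.equivFunOnFinite.symm.injective (eq_of_heq hb)
    simp only at ha
    have h0 : α ⟨0, (0 : Fin 2)⟩ = β ⟨0, (0 : Fin 2)⟩ := by omega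
    exact Subtype.ext (Idx_ext h0 ha (fun j => congrFun hb' j))
  · rintro ⟨⟨i, β⟩, h⟩
    simp only [Finset.mem_sigma, Finset.mem_range, Finset.mem_filter,
      Finset.mem_finsuppAntidiag] at h
    obtain ⟨h1, ⟨h2, -⟩, h3⟩ := h
    refine ⟨⟨mkIdx (m₁ - i) i β, ?_, ?_, ?_⟩, ?_⟩
    · change m₁ - i + i = m₁
      omega
    · exact h2
    · refine Eq.trans h3 ?_
      change lam - m₁ + 2 * i = lam - ((m₁ - i : ℕ) : ℤ) + (i : ℕ)
      rw [Nat.cast_sub (by omega)]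
      ring
    · apply Subtype.ext
      refine congrArg (Sigma.mk i) ?_
      ext j
      rfl

lemma omega_diff (m₁ m₂ : ℕ) :
    (omegaCount 2 ![1, 3] ![m₁, m₂] 0 : ℤ) - omegaCount 2 ![1, 3] ![m₁, m₂] 2 =
      (PowerSeries.coeff m₂ serU).coeff m₁ := by
  rw [omega_coeff, omega_coeff, ← serQ_diff, ← serQ_symm m₂ m₁, ← Finset.sum_sub_distrib]
  have := Finset.sum_range_sub' (fun i : ℕ => (PowerSeries.coeff m₂ serQ).coeff (0 - (m₁ : ℤ) + 2 * i)) (m₁ + 1)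
  rw [← sub_eq_zero]
  convert sub_eq_zero.2 this using 2
  · refine Finset.sum_congr rfl fun i _ => ?_
    congr 2
    push_cast
    ring
  · congr 2
    · simp
    · push_cast
      ring

end Counting
/-- The multivariate Poincaré series of the algebra of joint invariants of a binary
linear form and a binary cubic form is
`(1 + z₁²z₂² - z₁z₂) / ((1 - z₂⁴)(1 - z₁³z₂)(1 - z₁z₂))`: for `d = (1,3)`, the space of
joint invariants of multidegree `(m₁, m₂)` (polynomials with `D1 f = 0` and `D2 f = 0`)
has dimension equal to the coefficient of `z₁^{m₁} z₂^{m₂}` in that series.  The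
power-series variables are indexed by `Fin 2`, with `0 ↦ z₁` and `1 ↦ z₂`; the
denominator has constant term `1`, hence is invertible. -/
theorem poincare_series_invariants_d13 (m₁ m₂ : ℕ) :
    (Module.finrank ℂ ↥(mdeg 2 ![1, 3] ![m₁, m₂] ⊓
        LinearMap.ker (D1 2 ![1, 3]).toLinearMap ⊓
        LinearMap.ker (D2 2 ![1, 3]).toLinearMap) : ℤ) =
      MvPowerSeries.coeff (R := ℤ)
        (Finsupp.equivFunOnFinite.symm ![m₁, m₂])
        ((1 + MvPowerSeries.X (0 : Fin 2) ^ 2 * MvPowerSeries.X 1 ^ 2 -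
            MvPowerSeries.X 0 * MvPowerSeries.X 1) *
         MvPowerSeries.invOfUnit
          ((1 - MvPowerSeries.X (1 : Fin 2) ^ 4) *
           (1 - MvPowerSeries.X (0 : Fin 2) ^ 3 * MvPowerSeries.X 1) *
           (1 - MvPowerSeries.X (0 : Fin 2) * MvPowerSeries.X 1)) 1) := by
  rw [finrank_inv, omega_diff, transfer]
  rfl
end
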